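/- Let H be a connected reductive linear algebraic group over an algebraically closed field of characteristic zero, N and A normal algebraic subgroups of H, and B = C_H(A) the centralizer of A in H. Then N = (N ∩ A)(N ∩ B). -/

import Mathlib

open scoped MatrixGroups

noncomputable def entries {n : ℕ} {K : Type*} [Field K] (g : GL (Fin n) K) :
    Fin n × Fin n → K := fun p => (g : Matrix (Fin n) (Fin n) K) p.1 p.2

def IsZClosed {n : ℕ} {K : Type*} [Field K] (S : Set (GL (Fin n) K)) : Prop :=
  ∃ I : Set (MvPolynomial (Fin n × Fin n) K),
    S = {g : GL (Fin n) K | ∀ p ∈ I, MvPolynomial.eval (entries g) p = 0}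

def zClosure {n : ℕ} {K : Type*} [Field K] (S : Set (GL (Fin n) K)) :
    Set (GL (Fin n) K) :=
  {g : GL (Fin n) K | ∀ p : MvPolynomial (Fin n × Fin n) K,
    (∀ s ∈ S, MvPolynomial.eval (entries s) p = 0) →
      MvPolynomial.eval (entries g) p = 0}

def IsZConnected {n : ℕ} {K : Type*} [Field K] (S : Set (GL (Fin n) K)) : Prop :=
  ∀ U V : Set (GL (Fin n) K), IsZClosed U → IsZClosed V → S ⊆ U ∪ V →
    (S ∩ U).Nonempty → (S ∩ V).Nonempty → (S ∩ (U ∩ V)).Nonempty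

def IsUnipotentElt {n : ℕ} {K : Type*} [Field K] (g : GL (Fin n) K) : Prop :=
  ((g : Matrix (Fin n) (Fin n) K) - 1) ^ n = 0

def NormalIn {G : Type*} [Group G] (N H : Subgroup G) : Prop :=
  N ≤ H ∧ ∀ h ∈ H, ∀ x ∈ N, h * x * h⁻¹ ∈ N

def IsReductiveSub {n : ℕ} {K : Type*} [Field K] (H : Subgroup (GL (Fin n) K)) : Prop :=
  ∀ N : Subgroup (GL (Fin n) K), NormalIn N H →
    IsZClosed (N : Set (GL (Fin n) K)) → (∀ g ∈ N, IsUnipotentElt g) → N = ⊥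

namespace NDec

open MvPolynomial

/-- The coordinate ring of `n × n` matrices. -/
abbrev PR (n : ℕ) (K : Type*) [Field K] := MvPolynomial (Fin n × Fin n) K

section basics

open scoped MatrixGroups
variable {n : ℕ} {K : Type*} [Field K]

/-- Evaluation of a polynomial at a matrix with entries in a `K`-algebra. -/
noncomputable def ev {R : Type*} [CommRing R] [Algebra K R] (g : Matrix (Fin n) (Fin n) R) :
    PR n K →ₐ[K] R := aeval (fun p => g p.1 p.2)

@[simp] lemma ev_X {R : Type*} [CommRing R] [Algebra K R] (g : Matrix (Fin n) (Fin n) R)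
    (p : Fin n × Fin n) : ev (K := K) g (X p) = g p.1 p.2 := by simp [ev]

lemma eval_entries (g : GL (Fin n) K) (f : PR n K) :
    MvPolynomial.eval (entries g) f = ev (g : Matrix (Fin n) (Fin n) K) f := by
  simp [ev, aeval_eq_eval]
  rfl

lemma map_ev {R R' : Type*} [CommRing R] [Algebra K R] [CommRing R'] [Algebra K R']
    (φ : R →ₐ[K] R') (g : Matrix (Fin n) (Fin n) R) (f : PR n K) :
    φ (ev g f) = ev (g.map φ) f := by
  have : φ.comp (ev g) = ev (K := K) (g.map φ) := by
    apply MvPolynomial.algHom_ext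
    intro p; simp
  exact DFunLike.congr_fun this f

/-- The generic matrix. -/
noncomputable def gm : Matrix (Fin n) (Fin n) (PR n K) := Matrix.of fun i j => X (i, j)

@[simp] lemma gm_apply (i j : Fin n) : (gm : Matrix _ _ (PR n K)) i j = X (i, j) := rfl

@[simp] lemma gm_map {R : Type*} [CommRing R] [Algebra K R] (g : Matrix (Fin n) (Fin n) R) :
    (gm : Matrix _ _ (PR n K)).map (ev g) = g := by
  ext i j; simp

/-- A matrix over `K` seen over a `K`-algebra. -/
def cm {R : Type*} [CommRing R] [Algebra K R] (a : Matrix (Fin n) (Fin n) K) :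
    Matrix (Fin n) (Fin n) R := a.map (algebraMap K R)

section cm
variable {R : Type*} [CommRing R] [Algebra K R]

@[simp] lemma cm_apply (a : Matrix (Fin n) (Fin n) K) (i j : Fin n) :
    (cm a : Matrix _ _ R) i j = algebraMap K R (a i j) := rfl

@[simp] lemma cm_self (a : Matrix (Fin n) (Fin n) K) : (cm a : Matrix _ _ K) = a := rfl

lemma cm_mul (a b : Matrix (Fin n) (Fin n) K) : (cm (a * b) : Matrix _ _ R) = cm a * cm b := by
  simp [cm, Matrix.map_mul]

lemma cm_add (a b : Matrix (Fin n) (Fin n) K) : (cm (a + b) : Matrix _ _ R) = cm a + cm b := by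
  ext; simp

lemma cm_sub (a b : Matrix (Fin n) (Fin n) K) : (cm (a - b) : Matrix _ _ R) = cm a - cm b := by
  ext; simp

lemma cm_smul (c : K) (b : Matrix (Fin n) (Fin n) K) : (cm (c • b) : Matrix _ _ R) = c • cm b := by
  ext i j
  simp only [cm_apply, Matrix.smul_apply, smul_eq_mul, map_mul]
  rw [Algebra.smul_def]

@[simp] lemma cm_one : (cm (1 : Matrix (Fin n) (Fin n) K) : Matrix _ _ R) = 1 := by
  simp [cm]

@[simp] lemma cm_map {R' : Type*} [CommRing R'] [Algebra K R'] (φ : R →ₐ[K] R')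
    (a : Matrix (Fin n) (Fin n) K) : (cm a : Matrix _ _ R).map φ = cm a := by
  ext; simp

end cm

/-- Left translation: `(lt a f)(x) = f (a x)`. -/
noncomputable def lt (a : Matrix (Fin n) (Fin n) K) : PR n K →ₐ[K] PR n K :=
  ev (cm a * gm)

/-- Right translation: `(rt a f)(x) = f (x a)`. -/
noncomputable def rt (a : Matrix (Fin n) (Fin n) K) : PR n K →ₐ[K] PR n K :=
  ev (gm * cm a)

lemma ev_lt (a g : Matrix (Fin n) (Fin n) K) (f : PR n K) : ev g (lt a f) = ev (a * g) f := by
  rw [lt, map_ev, Matrix.map_mul]; simp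

lemma ev_rt (a g : Matrix (Fin n) (Fin n) K) (f : PR n K) : ev g (rt a f) = ev (g * a) f := by
  rw [rt, map_ev, Matrix.map_mul]; simp

/-- The left invariant derivation attached to a matrix. -/
noncomputable def D (A : Matrix (Fin n) (Fin n) K) : Derivation K (PR n K) (PR n K) :=
  mkDerivation K fun p => (gm * cm A : Matrix (Fin n) (Fin n) (PR n K)) p.1 p.2

@[simp] lemma D_X (A : Matrix (Fin n) (Fin n) K) (p : Fin n × Fin n) :
    D A (X p) = (gm * cm A : Matrix (Fin n) (Fin n) (PR n K)) p.1 p.2 := by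
  simp [D, mkDerivation_X]

lemma der_comm {R : Type*} [CommRing R] [Algebra K R] (γ : PR n K →ₐ[K] R)
    (d : Derivation K (PR n K) (PR n K)) (d' : Derivation K R R)
    (h : ∀ p, γ (d (X p)) = d' (γ (X p))) (f : PR n K) : γ (d f) = d' (γ f) := by
  induction f using MvPolynomial.induction_on with
  | C a =>
    rw [← MvPolynomial.algebraMap_eq, Derivation.map_algebraMap, AlgHom.commutes,
      Derivation.map_algebraMap, map_zero]
  | add p q hp hq => simp [hp, hq]
  | mul_X p i hp =>
    rw [Derivation.leibniz, map_add, smul_eq_mul, smul_eq_mul, map_mul, map_mul, hp, h, map_mul,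
      Derivation.leibniz, smul_eq_mul, smul_eq_mul]

lemma D_add (A B : Matrix (Fin n) (Fin n) K) : D (A + B) = D A + D B := by
  apply MvPolynomial.derivation_ext
  intro p
  rw [Derivation.add_apply, D_X, D_X, D_X, cm_add, Matrix.mul_add]
  rfl

lemma D_smul (c : K) (A : Matrix (Fin n) (Fin n) K) : D (c • A) = c • D A := by
  apply MvPolynomial.derivation_ext
  intro p
  rw [Derivation.smul_apply, D_X, D_X, cm_smul, Matrix.mul_smul]
  rfl

lemma D_lie (A B : Matrix (Fin n) (Fin n) K) : D (A * B - B * A) = ⁅D A, D B⁆ := by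
  have key : ∀ A B : Matrix (Fin n) (Fin n) K, ∀ p : Fin n × Fin n,
      D A (D B (X p)) = (gm * cm (A * B) : Matrix (Fin n) (Fin n) (PR n K)) p.1 p.2 := by
    intro A B p
    rw [D_X, Matrix.mul_apply, map_sum, cm_mul, ← Matrix.mul_assoc, Matrix.mul_apply]
    refine Finset.sum_congr rfl fun i _ => ?_
    rw [Derivation.leibniz, gm_apply, D_X]
    simp only [Matrix.map_apply, ← MvPolynomial.algebraMap_eq, Derivation.map_algebraMap]
    simp [mul_comm]
  apply MvPolynomial.derivation_ext
  intro p
  rw [Derivation.commutator_apply, key, key, D_X, cm_sub, Matrix.mul_sub]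
  rfl

lemma lt_D (a A : Matrix (Fin n) (Fin n) K) (f : PR n K) : lt a (D A f) = D A (lt a f) := by
  apply der_comm
  intro p
  have h1 : lt a (X p : PR n K) = ∑ k, algebraMap K (PR n K) (a p.1 k) * X (k, p.2) := by
    simp [lt, Matrix.mul_apply]
  rw [h1, D_X]
  simp only [Matrix.mul_apply, map_sum, map_mul, Derivation.leibniz, D_X]
  simp only [cm_apply, Derivation.map_algebraMap,
    AlgHom.commutes, mul_zero, add_zero, gm_apply, smul_eq_mul, Finset.mul_sum]
  rw [Finset.sum_comm]
  refine Finset.sum_congr rfl fun i _ => ?_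
  simp [lt, Matrix.mul_apply, Finset.sum_mul, mul_assoc]

lemma rt_D (a b A : Matrix (Fin n) (Fin n) K) (hab : b * a = 1) (f : PR n K) :
    rt a (D A f) = D (a * A * b) (rt a f) := by
  apply der_comm
  intro p
  have h1 : rt a (X p : PR n K) = ∑ k, X (p.1, k) * algebraMap K (PR n K) (a k p.2) := by
    simp [rt, Matrix.mul_apply]
  rw [h1, map_sum, D_X]
  have : ∀ k, D (a * A * b) (X (p.1, k) * algebraMap K (PR n K) (a k p.2) : PR n K) =
      (gm * cm (a * A * b) : Matrix (Fin n) (Fin n) (PR n K)) p.1 k * algebraMap K (PR n K) (a k p.2) := by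
    intro k
    rw [Derivation.leibniz, D_X]
    simp only [← MvPolynomial.algebraMap_eq, Derivation.map_algebraMap]
    simp [mul_comm]
  simp only [this]
  have h2 : ∑ k, (gm * cm (a * A * b) : Matrix (Fin n) (Fin n) (PR n K)) p.1 k * algebraMap K (PR n K) (a k p.2) =
      (gm * cm (a * A * b) * cm a : Matrix (Fin n) (Fin n) (PR n K)) p.1 p.2 := by
    rw [Matrix.mul_apply]; rfl
  rw [h2, Matrix.mul_assoc, ← cm_mul, Matrix.mul_assoc _ b a, hab, Matrix.mul_one,
    cm_mul, ← Matrix.mul_assoc, Matrix.mul_apply, Matrix.mul_apply, map_sum]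
  refine Finset.sum_congr rfl fun i _ => ?_
  rw [map_mul]
  congr 1
  · simp [rt]
  · simp only [cm_apply, AlgHom.commutes]

/-- Vanishing ideal of a set of invertible matrices. -/
noncomputable def vI (S : Set (GL (Fin n) K)) : Ideal (PR n K) where
  carrier := {f | ∀ g ∈ S, ev (g : Matrix (Fin n) (Fin n) K) f = 0}
  add_mem' := by intro a b ha hb g hg; simp [ha g hg, hb g hg]
  zero_mem' := by intro g _; simp
  smul_mem' := by intro c f hf g hg; simp [hf g hg]

lemma mem_vI {S : Set (GL (Fin n) K)} {f : PR n K} :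
    f ∈ vI S ↔ ∀ g ∈ S, ev (g : Matrix (Fin n) (Fin n) K) f = 0 := Iff.rfl

lemma mem_of_closed {S : Set (GL (Fin n) K)} (hS : IsZClosed S) (g : GL (Fin n) K)
    (h : ∀ f ∈ vI S, ev (g : Matrix (Fin n) (Fin n) K) f = 0) : g ∈ S := by
  obtain ⟨I, hI⟩ := hS
  rw [hI]
  intro p hp
  rw [eval_entries]
  apply h
  intro s hs
  rw [hI] at hs
  have := hs p hp
  rwa [eval_entries] at this

lemma closed_of (S : Set (GL (Fin n) K)) (I : Set (PR n K))
    (h : ∀ g : GL (Fin n) K, g ∈ S ↔ ∀ f ∈ I, ev (g : Matrix (Fin n) (Fin n) K) f = 0) :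
    IsZClosed S := by
  refine ⟨I, ?_⟩
  ext g
  simp only [h g, Set.mem_setOf_eq, eval_entries]

lemma closed_inter {S T : Set (GL (Fin n) K)} (hS : IsZClosed S) (hT : IsZClosed T) :
    IsZClosed (S ∩ T) := by
  obtain ⟨I, rfl⟩ := hS
  obtain ⟨J, rfl⟩ := hT
  refine ⟨I ∪ J, ?_⟩
  ext g
  simp only [Set.mem_inter_iff, Set.mem_setOf_eq, Set.mem_union, or_imp, forall_and]

lemma closed_union {S T : Set (GL (Fin n) K)} (hS : IsZClosed S) (hT : IsZClosed T) :
    IsZClosed (S ∪ T) := by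
  obtain ⟨I, rfl⟩ := hS
  obtain ⟨J, rfl⟩ := hT
  refine ⟨{h | ∃ f ∈ I, ∃ g ∈ J, h = f * g}, ?_⟩
  ext g
  simp only [Set.mem_union, Set.mem_setOf_eq]
  constructor
  · rintro (h | h) _ ⟨p, hp, q, hq, rfl⟩
    · simp [h p hp]
    · simp [h q hq]
  · intro h
    by_contra hc
    push Not at hc
    obtain ⟨⟨p, hp, hp'⟩, q, hq, hq'⟩ := hc
    have := h _ ⟨p, hp, q, hq, rfl⟩
    rw [map_mul] at this
    exact (mul_ne_zero hp' hq') this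

lemma closed_empty : IsZClosed (∅ : Set (GL (Fin n) K)) := ⟨{1}, by ext g; simp⟩

/-- A linear condition on matrices is closed. -/
lemma closed_linear (W : Submodule K (Matrix (Fin n) (Fin n) K)) (a : Matrix (Fin n) (Fin n) K) :
    IsZClosed {g : GL (Fin n) K | (g : Matrix (Fin n) (Fin n) K) - a ∈ W} := by
  let lin : Module.Dual K (Matrix (Fin n) (Fin n) K) → PR n K := fun φ =>
    (∑ p : Fin n × Fin n, C (φ (Matrix.single p.1 p.2 1)) * X p) - C (φ a)
  have hlin : ∀ (φ : Module.Dual K (Matrix (Fin n) (Fin n) K)) (g : Matrix (Fin n) (Fin n) K),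
      ev g (lin φ) = φ (g - a) := by
    intro φ g
    have : φ g = ∑ p : Fin n × Fin n, φ (Matrix.single p.1 p.2 1) * g p.1 p.2 := by
      conv_lhs => rw [Matrix.matrix_eq_sum_single g]
      rw [map_sum, Fintype.sum_prod_type]
      refine Finset.sum_congr rfl fun i _ => ?_
      rw [map_sum]
      refine Finset.sum_congr rfl fun j _ => ?_
      rw [show Matrix.single i j (g i j) = g i j • Matrix.single i j (1 : K) by simp, map_smul,
        smul_eq_mul, mul_comm]
    rw [map_sub φ, this]
    simp only [lin, map_sub, map_sum, map_mul, ev_X, ← MvPolynomial.algebraMap_eq,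
      AlgHom.commutes]
    simp
  refine closed_of _ {f | ∃ φ ∈ W.dualAnnihilator, f = lin φ} ?_
  intro g
  simp only [Set.mem_setOf_eq]
  constructor
  · rintro h _ ⟨φ, hφ, rfl⟩
    rw [hlin]
    exact (Submodule.mem_dualAnnihilator φ).1 hφ _ h
  · intro h
    rw [← Subspace.dualAnnihilator_dualCoannihilator_eq (W := W), Submodule.mem_dualCoannihilator]
    intro φ hφ
    rw [← hlin]
    exact h _ ⟨φ, hφ, rfl⟩

end basics

end NDec

namespace NDec

open MvPolynomial

section lie

open scoped MatrixGroups
variable {n : ℕ} {K : Type*} [Field K]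

/-- The Lie algebra of a (closed sub)group, as a subspace of matrices. -/
noncomputable def LieS (S : Set (GL (Fin n) K)) : Submodule K (Matrix (Fin n) (Fin n) K) where
  carrier := {A | ∀ f ∈ vI S, D A f ∈ vI S}
  add_mem' := by
    intro A B hA hB f hf
    rw [D_add]
    exact Ideal.add_mem _ (hA f hf) (hB f hf)
  zero_mem' := by
    intro f hf
    have := D_smul (0 : K) (0 : Matrix (Fin n) (Fin n) K)
    rw [zero_smul, zero_smul] at this
    rw [this]
    exact Ideal.zero_mem _
  smul_mem' := by
    intro c A hA f hf
    rw [D_smul, Derivation.smul_apply, MvPolynomial.smul_eq_C_mul]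
    exact Ideal.mul_mem_left _ _ (hA f hf)

lemma mem_LieS {S : Set (GL (Fin n) K)} {A : Matrix (Fin n) (Fin n) K} :
    A ∈ LieS S ↔ ∀ f ∈ vI S, D A f ∈ vI S := Iff.rfl

lemma lie_mem_LieS {S : Set (GL (Fin n) K)} {A B : Matrix (Fin n) (Fin n) K} (hA : A ∈ LieS S)
    (hB : B ∈ LieS S) : A * B - B * A ∈ LieS S := by
  intro f hf
  rw [D_lie, Derivation.commutator_apply]
  exact Ideal.sub_mem _ (hA _ (hB _ hf)) (hB _ (hA _ hf))

lemma lt_mem_vI {S : Subgroup (GL (Fin n) K)} {g : GL (Fin n) K} (hg : g ∈ S) {f : PR n K}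
    (hf : f ∈ vI (S : Set (GL (Fin n) K))) :
    lt (g : Matrix (Fin n) (Fin n) K) f ∈ vI (S : Set (GL (Fin n) K)) := by
  intro h hh
  rw [ev_lt, ← Units.val_mul]
  exact hf _ (S.mul_mem hg hh)

lemma mem_LieS_iff {S : Subgroup (GL (Fin n) K)} {A : Matrix (Fin n) (Fin n) K} :
    A ∈ LieS (S : Set (GL (Fin n) K)) ↔
      ∀ f ∈ vI (S : Set (GL (Fin n) K)), ev (1 : Matrix (Fin n) (Fin n) K) (D A f) = 0 := by
  constructor
  · intro h f hf
    exact h f hf 1 S.one_mem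
  · intro h f hf g hg
    have := h _ (lt_mem_vI hg hf)
    rwa [← lt_D, ev_lt, mul_one] at this

lemma conj_mem_LieS {S : Set (GL (Fin n) K)} {h : GL (Fin n) K}
    (h1 : ∀ g ∈ S, h * g * h⁻¹ ∈ S) (h2 : ∀ g ∈ S, h⁻¹ * g * h ∈ S)
    {A : Matrix (Fin n) (Fin n) K} (hA : A ∈ LieS S) :
    (h : Matrix (Fin n) (Fin n) K) * A * (h⁻¹ : GL (Fin n) K) ∈ LieS S := by
  intro f hf g hg
  have hh : (h : Matrix (Fin n) (Fin n) K) * (h⁻¹ : GL (Fin n) K) = 1 := by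
    rw [← Units.val_mul, mul_inv_cancel]; rfl
  have hh' : ((h⁻¹ : GL (Fin n) K) : Matrix (Fin n) (Fin n) K) * (h : GL (Fin n) K) = 1 := by
    rw [← Units.val_mul, inv_mul_cancel]; rfl
  set a : Matrix (Fin n) (Fin n) K := (h : Matrix (Fin n) (Fin n) K) with ha
  set b : Matrix (Fin n) (Fin n) K := ((h⁻¹ : GL (Fin n) K) : Matrix (Fin n) (Fin n) K) with hb
  have e1 := rt_D b a (a * A * b) hh f
  rw [show b * (a * A * b) * a = A by
    rw [← mul_assoc, ← mul_assoc, hh', one_mul, mul_assoc, hh', mul_one]] at e1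
  have e2 : lt a (rt b f) ∈ vI S := by
    intro x hx
    rw [ev_lt, ev_rt]
    have := hf _ (h1 x hx)
    rwa [Units.val_mul, Units.val_mul] at this
  have e3 := hA _ e2 _ (h2 g hg)
  rw [← lt_D, ← e1, ev_lt, ev_rt, Units.val_mul, Units.val_mul, ← ha, ← hb] at e3
  rwa [show a * (b * (g : Matrix (Fin n) (Fin n) K) * a) * b = g by
    rw [← mul_assoc, ← mul_assoc, hh, one_mul, mul_assoc, hh, mul_one]] at e3

/-- `exp (t A)` over power series. -/
noncomputable def ex (A : Matrix (Fin n) (Fin n) K) :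
    Matrix (Fin n) (Fin n) (PowerSeries K) :=
  Matrix.of fun i j => PowerSeries.mk fun k => (k.factorial : K)⁻¹ * (A ^ k) i j

lemma coeff_ex (A : Matrix (Fin n) (Fin n) K) (i j : Fin n) (k : ℕ) :
    PowerSeries.coeff k (ex A i j) = (k.factorial : K)⁻¹ * (A ^ k) i j := by
  simp [ex]

/-- constant coefficient as an algebra morphism -/
noncomputable def cc (K : Type*) [Field K] : PowerSeries K →ₐ[K] K :=
  { (PowerSeries.constantCoeff : PowerSeries K →+* K) with
    commutes' := by intro r; simp [PowerSeries.algebraMap_apply] }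

lemma cc_apply (f : PowerSeries K) : cc K f = PowerSeries.coeff 0 f := by
  rw [PowerSeries.coeff_zero_eq_constantCoeff_apply]
  rfl

lemma ex_cc (A : Matrix (Fin n) (Fin n) K) : (ex A).map (cc K) = 1 := by
  ext i j
  rw [Matrix.map_apply, cc_apply, coeff_ex]
  simp

lemma isUnit_det_ex (A : Matrix (Fin n) (Fin n) K) : IsUnit (ex A).det := by
  rw [PowerSeries.isUnit_iff_constantCoeff]
  have : PowerSeries.constantCoeff (ex A).det = cc K (ex A).det := rfl
  rw [this, AlgHom.map_det, AlgHom.mapMatrix_apply, ex_cc]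
  simp

lemma deriv_ex [CharZero K] (A : Matrix (Fin n) (Fin n) K) (i j : Fin n) :
    PowerSeries.derivative K (ex A i j) =
      (ex A * cm A : Matrix (Fin n) (Fin n) (PowerSeries K)) i j := by
  ext k
  rw [PowerSeries.coeff_derivative, coeff_ex, Matrix.mul_apply, map_sum]
  have : ∀ l, PowerSeries.coeff k (ex A i l * (cm A : Matrix _ _ (PowerSeries K)) l j)
      = (k.factorial : K)⁻¹ * ((A ^ k) i l * A l j) := by
    intro l
    rw [cm_apply, PowerSeries.algebraMap_apply, mul_comm]
    simp [coeff_ex]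
    ring
  simp only [this]
  rw [← Finset.mul_sum, ← Matrix.mul_apply, ← pow_succ, Nat.factorial_succ]
  push_cast
  have h1 : (k : K) + 1 ≠ 0 := by exact_mod_cast Nat.succ_ne_zero k
  have h2 : (k.factorial : K) ≠ 0 := by exact_mod_cast k.factorial_ne_zero
  field_simp

lemma ev_ex [CharZero K] (S : Set (GL (Fin n) K)) (h1 : 1 ∈ S) {A : Matrix (Fin n) (Fin n) K}
    (hA : A ∈ LieS S) {f : PR n K} (hf : f ∈ vI S) : ev (ex A) f = 0 := by
  have comm : ∀ f : PR n K, ev (ex A) (D A f) = PowerSeries.derivative K (ev (ex A) f) := by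
    apply der_comm
    intro p
    rw [D_X, ev_X, deriv_ex]
    have : ev (ex A) ((gm * cm A : Matrix (Fin n) (Fin n) (PR n K)) p.1 p.2) =
      ((gm * cm A : Matrix (Fin n) (Fin n) (PR n K)).map (ev (ex A))) p.1 p.2 := rfl
    rw [this, Matrix.map_mul]
    simp
  have key : ∀ k : ℕ, ∀ f ∈ vI S, PowerSeries.coeff k (ev (ex A) f) = 0 := by
    intro k
    induction k with
    | zero =>
      intro f hf
      rw [← cc_apply, map_ev, ex_cc]
      exact hf 1 h1
    | succ k ih =>
      intro f hf
      have := ih _ (hA f hf)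
      rw [comm, PowerSeries.coeff_derivative] at this
      have h1 : (k : K) + 1 ≠ 0 := by exact_mod_cast Nat.succ_ne_zero k
      exact (mul_eq_zero.1 this).resolve_right h1
  ext k
  rw [key k f hf]; simp

/-- Nilpotent elements of the Lie algebra exponentiate into a closed subgroup. -/
lemma exp_mem [CharZero K] {S : Set (GL (Fin n) K)} (hS : IsZClosed S) (h1 : 1 ∈ S)
    {A : Matrix (Fin n) (Fin n) K} (hA : A ∈ LieS S) (m : ℕ) (hm : A ^ m = 0)
    (g : GL (Fin n) K) (hg : (g : Matrix (Fin n) (Fin n) K) =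
      ∑ k ∈ Finset.range m, (k.factorial : K)⁻¹ • A ^ k) : g ∈ S := by
  apply mem_of_closed hS
  intro f hf
  let G : Matrix (Fin n) (Fin n) (Polynomial K) := Matrix.of fun i j =>
    ∑ k ∈ Finset.range m, Polynomial.monomial k ((k.factorial : K)⁻¹ * (A ^ k) i j)
  let φ : Polynomial K →ₐ[K] PowerSeries K := Polynomial.coeToPowerSeries.algHom K
  have hφ : Function.Injective φ := by
    intro a b hab
    simpa [φ, Polynomial.coeToPowerSeries.algHom_apply] using hab
  have hG : G.map φ = ex A := by
    ext i j k
    rw [coeff_ex, Matrix.map_apply, Polynomial.coeToPowerSeries.algHom_apply]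
    have hGij : G i j = ∑ k ∈ Finset.range m,
      Polynomial.monomial k ((k.factorial : K)⁻¹ * (A ^ k) i j) := rfl
    rw [hGij]
    simp only [Algebra.algebraMap_self, PowerSeries.map_id, id_eq,
      Polynomial.coeff_coe, Polynomial.finset_sum_coeff,
      Polynomial.coeff_monomial]
    simp only [Finset.sum_ite_eq', Finset.mem_range]
    split_ifs with h
    · rfl
    · rw [pow_eq_zero_of_le (not_lt.1 h) hm]; simp
  have h2 : ev G f = 0 := by
    apply hφ
    rw [map_ev, hG, map_zero]
    exact ev_ex S h1 hA hf
  have h3 : (g : Matrix (Fin n) (Fin n) K) = G.map (Polynomial.aeval (R := K) (1 : K)) := by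
    rw [hg]
    ext i j
    simp [G, Matrix.sum_apply, Polynomial.eval_finset_sum]
  rw [h3, ← map_ev, h2, map_zero]

end lie

end NDec

namespace NDec

open MvPolynomial

section dual

open scoped MatrixGroups
universe u
variable {n : ℕ} {K : Type u} [Field K]

lemma inv_lemma (F : MvPolynomial ((Fin n × Fin n) ⊕ (Fin n × Fin n)) K) :
    ∃ (q : PR n K) (d : ℕ), ∀ (R : Type u) [CommRing R] [Algebra K R]
      (h k : Matrix (Fin n) (Fin n) R), h * k = 1 →
        ev h q = h.det ^ d *
          aeval (Sum.elim (fun p => h p.1 p.2) (fun p => k p.1 p.2)) F := by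
  induction F using MvPolynomial.induction_on with
  | C a =>
    refine ⟨C a, 0, ?_⟩
    intro R _ _ h k _
    rw [← MvPolynomial.algebraMap_eq, AlgHom.commutes, ← MvPolynomial.algebraMap_eq,
      AlgHom.commutes]
    simp
  | add p q hp hq =>
    obtain ⟨q1, d1, h1⟩ := hp
    obtain ⟨q2, d2, h2⟩ := hq
    refine ⟨q1 * gm.det ^ d2 + q2 * gm.det ^ d1, d1 + d2, ?_⟩
    intro R _ _ h k hk
    have hdet : ev (K := K) h gm.det = h.det := by
      rw [AlgHom.map_det, AlgHom.mapMatrix_apply, gm_map]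
    rw [map_add, map_mul, map_mul, map_pow, map_pow, hdet, h1 R h k hk, h2 R h k hk, map_add]
    ring
  | mul_X p i hp =>
    obtain ⟨q1, d1, h1⟩ := hp
    rcases i with i | i
    · refine ⟨q1 * X i, d1, ?_⟩
      intro R _ _ h k hk
      rw [map_mul, h1 R h k hk, ev_X, map_mul, aeval_X]
      simp [mul_assoc]
    · refine ⟨q1 * gm.adjugate i.1 i.2, d1 + 1, ?_⟩
      intro R _ _ h k hk
      have hadj : ev (K := K) h (gm.adjugate i.1 i.2) = h.det * k i.1 i.2 := by
        have e1 : ev (K := K) h (gm.adjugate i.1 i.2)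
          = ((gm.adjugate).map (ev (K := K) h)) i.1 i.2 := rfl
        rw [e1, ← AlgHom.mapMatrix_apply, AlgHom.map_adjugate, AlgHom.mapMatrix_apply, gm_map]
        have e2 : h.adjugate = h.det • k := by
          calc h.adjugate = h.adjugate * (h * k) := by rw [hk, mul_one]
            _ = h.det • k := by rw [← mul_assoc, Matrix.adjugate_mul, Matrix.smul_mul, one_mul]
        rw [e2]; rfl
      rw [map_mul, h1 R h k hk, hadj, map_mul, aeval_X]
      simp only [Sum.elim_inr]
      ring

open DualNumber in
lemma ev_dual (Z : Matrix (Fin n) (Fin n) K) (f : PR n K) :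
    ev (1 + (ε : DualNumber K) • (cm Z : Matrix (Fin n) (Fin n) (DualNumber K))) f =
      algebraMap K (DualNumber K) (ev (1 : Matrix (Fin n) (Fin n) K) f) +
        (ev (1 : Matrix (Fin n) (Fin n) K) (D Z f)) • (ε : DualNumber K) := by
  induction f using MvPolynomial.induction_on with
  | C a =>
    rw [← MvPolynomial.algebraMap_eq, AlgHom.commutes, AlgHom.commutes, Derivation.map_algebraMap]
    simp
  | add p q hp hq =>
    rw [map_add, hp, hq]
    simp only [map_add, add_smul]
    ring
  | mul_X p i hp =>
    have hX : ev (1 : Matrix (Fin n) (Fin n) K) (D Z (X i)) = Z i.1 i.2 := by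
      rw [D_X]
      have : ev (1 : Matrix (Fin n) (Fin n) K)
          ((gm * cm Z : Matrix (Fin n) (Fin n) (PR n K)) i.1 i.2) =
        ((gm * cm Z : Matrix (Fin n) (Fin n) (PR n K)).map
          (ev (1 : Matrix (Fin n) (Fin n) K))) i.1 i.2 := rfl
      rw [this, Matrix.map_mul]
      simp
    have hone : (1 : Matrix (Fin n) (Fin n) (DualNumber K)) i.1 i.2 =
        algebraMap K (DualNumber K) ((1 : Matrix (Fin n) (Fin n) K) i.1 i.2) := by
      rw [← cm_apply, cm_one]
    rw [map_mul, hp, ev_X, Derivation.leibniz, map_add, smul_eq_mul, smul_eq_mul, map_mul, map_mul,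
      map_mul, hX, ev_X, Matrix.add_apply, Matrix.smul_apply, cm_apply, hone]
    have he : (ε : DualNumber K) * ε = 0 := eps_mul_eps
    simp only [ev_X, Algebra.smul_def, map_add, map_mul, smul_eq_mul, Algebra.algebraMap_self_apply]
    linear_combination (algebraMap K (DualNumber K) (ev (1 : Matrix (Fin n) (Fin n) K) (D Z p))
      * algebraMap K (DualNumber K) (Z i.1 i.2)) * he

open DualNumber in
/-- If `M` is normal in `H`, then `M` acts trivially on `Lie H / Lie M`. -/
lemma ad_sub_mem {H M : Subgroup (GL (Fin n) K)} (hM : NormalIn M H)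
    {A : Matrix (Fin n) (Fin n) K} (hA : A ∈ LieS (H : Set (GL (Fin n) K)))
    {m : GL (Fin n) K} (hm : m ∈ M) :
    (m : Matrix (Fin n) (Fin n) K) * A * (m⁻¹ : GL (Fin n) K) - A ∈
      LieS (M : Set (GL (Fin n) K)) := by
  rw [mem_LieS_iff]
  intro f hf
  set a : Matrix (Fin n) (Fin n) K := (m : Matrix (Fin n) (Fin n) K) with ha
  set b : Matrix (Fin n) (Fin n) K := ((m⁻¹ : GL (Fin n) K) : Matrix (Fin n) (Fin n) K) with hb
  have hab : a * b = 1 := by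
    rw [ha, hb, ← Units.val_mul, mul_inv_cancel]; rfl
  let U : Matrix (Fin n) (Fin n) (MvPolynomial ((Fin n × Fin n) ⊕ (Fin n × Fin n)) K) :=
    Matrix.of fun i j => X (Sum.inl (i, j))
  let V : Matrix (Fin n) (Fin n) (MvPolynomial ((Fin n × Fin n) ⊕ (Fin n × Fin n)) K) :=
    Matrix.of fun i j => X (Sum.inr (i, j))
  obtain ⟨q, d, hq⟩ := inv_lemma (ev (cm a * U * cm b * V) f)
  have hF : ∀ (R : Type u) [CommRing R] [Algebra K R] (h k : Matrix (Fin n) (Fin n) R),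
      aeval (Sum.elim (fun p : Fin n × Fin n => h p.1 p.2) (fun p => k p.1 p.2))
        (ev (cm a * U * cm b * V) f) = ev (cm a * h * cm b * k) f := by
    intro R _ _ h k
    rw [map_ev, Matrix.map_mul, Matrix.map_mul, Matrix.map_mul, cm_map, cm_map]
    congr 3
    · congr 2
      ext i j; simp [U]
    · ext i j; simp [V]
  have hqH : q ∈ vI (H : Set (GL (Fin n) K)) := by
    intro h hh
    have hk : (h : Matrix (Fin n) (Fin n) K) * ((h⁻¹ : GL (Fin n) K) : Matrix (Fin n) (Fin n) K)
      = 1 := by rw [← Units.val_mul, mul_inv_cancel]; rfl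
    rw [hq K _ _ hk, hF, cm_self, cm_self, ha, hb, ← Units.val_mul, ← Units.val_mul,
      ← Units.val_mul, hf, mul_zero]
    rw [mul_assoc, mul_assoc, ← mul_assoc h]
    exact M.mul_mem hm (hM.2 h hh _ (M.inv_mem hm))
  have he : (ε : DualNumber K) * ε = 0 := eps_mul_eps
  let cA : Matrix (Fin n) (Fin n) (DualNumber K) := cm A
  have h0 : (1 + (ε : DualNumber K) • cA) * (1 - (ε : DualNumber K) • cA) = 1 := by
    rw [add_mul, mul_sub, mul_sub]
    simp only [one_mul, mul_one, Matrix.smul_mul, Matrix.mul_smul, smul_smul, he, zero_smul]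
    abel
  have h1 := hq (DualNumber K) _ _ h0
  have h2 : ev (1 + (ε : DualNumber K) • cA) q = 0 := by
    rw [ev_dual, mem_LieS_iff.1 hA q hqH]
    have := hqH 1 H.one_mem
    rw [Units.val_one] at this
    rw [this]
    simp
  have h3 : IsUnit (1 + (ε : DualNumber K) • cA).det := by
    apply IsUnit.of_mul_eq_one ((1 - (ε : DualNumber K) • cA).det)
    rw [← Matrix.det_mul, h0, Matrix.det_one]
  rw [h2, hF] at h1
  have h4 := ((h3.pow d).mul_right_eq_zero).1 h1.symm
  have h5 : (cm a * (1 + (ε : DualNumber K) • cA) * cm b * (1 - (ε : DualNumber K) • cA)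
      : Matrix (Fin n) (Fin n) (DualNumber K)) =
      1 + (ε : DualNumber K) • (cm (a * A * b - A)) := by
    have hab' : (cm a * cm b : Matrix (Fin n) (Fin n) (DualNumber K)) = 1 := by
      rw [← cm_mul, hab, cm_one]
    rw [cm_sub, cm_mul, cm_mul]
    simp only [mul_add, mul_sub, add_mul, mul_one, Matrix.smul_mul, Matrix.mul_smul, smul_smul, he,
      zero_smul, hab', smul_sub, one_mul, cA]
    abel
  rw [h5, ev_dual] at h4
  have h6 := congrArg TrivSqZeroExt.snd h4
  simpa [TrivSqZeroExt.algebraMap_eq_inl] using h6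

end dual

end NDec

namespace NDec

open MvPolynomial

section replica

open scoped MatrixGroups
variable {n : ℕ} {K : Type*} [Field K]

lemma crt (s : Finset K) (N : ℕ) (c : K → K) :
    ∃ q : Polynomial K, ∀ μ ∈ s,
      (Polynomial.X - Polynomial.C μ) ^ N ∣ q - Polynomial.C (c μ) := by
  obtain ⟨q, hq⟩ := Ideal.exists_forall_sub_mem_ideal
    (I := fun μ : s => Ideal.span {(Polynomial.X - Polynomial.C (μ : K)) ^ N})
    (by
      intro i j hij
      rw [Function.onFun, Ideal.isCoprime_span_singleton_iff]
      exact (Polynomial.isCoprime_X_sub_C_of_isUnit_sub (by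
        rw [isUnit_iff_ne_zero]
        exact sub_ne_zero.2 (fun h => hij (Subtype.ext h)))).pow)
    (fun μ => Polynomial.C (c μ))
  exact ⟨q, fun μ hμ => Ideal.mem_span_singleton.1 (hq ⟨μ, hμ⟩)⟩

lemma crt_apply {V : Type*} [AddCommGroup V] [Module K V] (T : Module.End K V) {μ c : K} {N : ℕ}
    {q : Polynomial K} (hq : (Polynomial.X - Polynomial.C μ) ^ N ∣ q - Polynomial.C c) {v : V}
    (hv : ((T - μ • 1) ^ N) v = 0) : Polynomial.aeval T q v = c • v := by
  obtain ⟨r, hr⟩ := hq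
  have : q = r * (Polynomial.X - Polynomial.C μ) ^ N + Polynomial.C c := by
    rw [mul_comm, ← hr]; ring
  rw [this]
  simp only [map_add, map_mul, map_pow, map_sub, Polynomial.aeval_X, Polynomial.aeval_C,
    LinearMap.add_apply, Module.End.mul_apply]
  rw [Algebra.algebraMap_eq_smul_one, hv, Algebra.algebraMap_eq_smul_one]
  simp

lemma pow_zero_of_le {V : Type*} [AddCommGroup V] [Module K V] (T : Module.End K V) {a b : ℕ}
    (hab : a ≤ b) {v : V} (hv : (T ^ a) v = 0) : (T ^ b) v = 0 := by
  obtain ⟨c, rfl⟩ := Nat.exists_eq_add_of_le' hab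
  rw [pow_add, Module.End.mul_apply, hv, map_zero]

lemma aeval_mem {V : Type*} [AddCommGroup V] [Module K V] (T : Module.End K V)
    (W : Submodule K V) (hW : ∀ v ∈ W, T v ∈ W) (q : Polynomial K) {v : V} (hv : v ∈ W) :
    Polynomial.aeval T q v ∈ W := by
  have hp : ∀ k : ℕ, (T ^ k) v ∈ W := by
    intro k
    induction k with
    | zero => simpa
    | succ k ih => rw [pow_succ', Module.End.mul_apply]; exact hW _ ih
  induction q using Polynomial.induction_on' with
  | add p q hp hq => rw [map_add]; exact W.add_mem hp hq
  | monomial k a =>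
    rw [Polynomial.aeval_monomial, Module.End.mul_apply, Algebra.algebraMap_eq_smul_one]
    simpa using W.smul_mem a (hp k)

lemma leib_pow (d : Derivation K (PR n K) (PR n K)) (μ ν : K) : ∀ (k a b : ℕ), a + b ≤ k →
    ∀ f g : PR n K, ((d.toLinearMap - μ • 1 : Module.End K (PR n K)) ^ a) f = 0 →
      ((d.toLinearMap - ν • 1 : Module.End K (PR n K)) ^ b) g = 0 →
      ((d.toLinearMap - (μ + ν) • 1 : Module.End K (PR n K)) ^ k) (f * g) = 0 := by
  intro k
  induction k with
  | zero =>
    intro a b hab f g hf hg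
    obtain rfl : a = 0 := by omega
    simp at hf
    simp [hf]
  | succ k ih =>
    intro a b hab f g hf hg
    rcases a with _ | a
    · simp at hf
      simp [hf]
    rcases b with _ | b
    · simp at hg
      simp [hg]
    have e : (d.toLinearMap - (μ + ν) • 1 : Module.End K (PR n K)) (f * g) =
        ((d.toLinearMap - μ • 1 : Module.End K (PR n K)) f) * g +
          f * ((d.toLinearMap - ν • 1 : Module.End K (PR n K)) g) := by
      simp only [LinearMap.sub_apply, LinearMap.smul_apply, Module.End.one_apply,
        Derivation.coeFn_coe, Derivation.leibniz, smul_eq_mul, MvPolynomial.smul_eq_C_mul, map_add]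
      ring
    rw [pow_succ, Module.End.mul_apply, e, map_add]
    rw [pow_succ, Module.End.mul_apply] at hf hg
    rw [ih a (b+1) (by omega) _ _ hf (by rw [pow_succ, Module.End.mul_apply]; exact hg),
      ih (a+1) b (by omega) _ _ (by rw [pow_succ, Module.End.mul_apply]; exact hf) hg, add_zero]

/-- row linear forms -/
noncomputable def rowL (i : Fin n) : (Fin n → K) →ₗ[K] PR n K where
  toFun v := ∑ j, v j • X (i, j)
  map_add' := by intro v w; simp [add_smul, Finset.sum_add_distrib]
  map_smul' := by intro c v; simp [Finset.smul_sum, smul_smul]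

lemma D_rowL (B : Matrix (Fin n) (Fin n) K) (i : Fin n) (v : Fin n → K) :
    D B (rowL i v) = rowL i (B.mulVec v) := by
  simp only [rowL, LinearMap.coe_mk, AddHom.coe_mk, map_sum, Derivation.map_smul, D_X,
    Matrix.mul_apply, gm_apply, cm_apply, Matrix.mulVec, dotProduct, Finset.smul_sum,
    Finset.sum_smul]
  rw [Finset.sum_comm]
  refine Finset.sum_congr rfl fun j _ => Finset.sum_congr rfl fun k _ => ?_
  rw [MvPolynomial.smul_eq_C_mul, MvPolynomial.smul_eq_C_mul, map_mul, MvPolynomial.algebraMap_eq]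
  ring

/-- the graded pieces -/
noncomputable def Gp (A Y : Matrix (Fin n) (Fin n) K) (c : K → K) (μ : K) :
    Submodule K (PR n K) :=
  Module.End.maxGenEigenspace ((D A).toLinearMap) μ ⊓
    LinearMap.ker ((D Y).toLinearMap - c μ • (1 : Module.End K (PR n K)))

lemma mem_Gp {A Y : Matrix (Fin n) (Fin n) K} {c : K → K} {μ : K} {f : PR n K} :
    f ∈ Gp A Y c μ ↔ (∃ k : ℕ, (((D A).toLinearMap - μ • 1 : Module.End K (PR n K)) ^ k) f = 0) ∧
      D Y f = c μ • f := by
  rw [Gp, Submodule.mem_inf, Module.End.mem_maxGenEigenspace, LinearMap.mem_ker,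
    LinearMap.sub_apply, sub_eq_zero]
  rfl

lemma replica_mem [IsAlgClosed K] (S : Set (GL (Fin n) K)) {A Y : Matrix (Fin n) (Fin n) K}
    (hA : A ∈ LieS S) (c : K → K) (hc : ∀ a b, c (a + b) = c a + c b)
    (hY : ∀ μ, ∀ v ∈ Module.End.maxGenEigenspace (Matrix.toLin' A) μ, Y.mulVec v = c μ • v) :
    Y ∈ LieS S := by
  have hc0 : c 0 = 0 := by simpa using hc 0 0
  have hmul : ∀ f ∈ ⨆ μ, Gp A Y c μ, ∀ g ∈ ⨆ μ, Gp A Y c μ, f * g ∈ ⨆ μ, Gp A Y c μ := by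
    intro f hf g hg
    induction hf using Submodule.iSup_induction' with
    | zero => simp
    | add f f' _ _ h h' => rw [add_mul]; exact Submodule.add_mem _ h h'
    | mem μ f hf =>
      induction hg using Submodule.iSup_induction' with
      | zero => simp
      | add f f' _ _ h h' => rw [mul_add]; exact Submodule.add_mem _ h h'
      | mem ν g hg =>
        apply Submodule.mem_iSup_of_mem (μ + ν)
        rw [mem_Gp] at hf hg ⊢
        obtain ⟨⟨a, ha⟩, hf⟩ := hf
        obtain ⟨⟨b, hb⟩, hg⟩ := hg
        refine ⟨⟨a + b, leib_pow _ _ _ _ a b le_rfl _ _ ha hb⟩, ?_⟩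
        rw [Derivation.leibniz, hf, hg, hc]
        simp only [smul_eq_mul, MvPolynomial.smul_eq_C_mul, map_add]
        ring
  have hX : ∀ p, (X p : PR n K) ∈ ⨆ μ, Gp A Y c μ := by
    intro p
    have h1 : (X p : PR n K) = rowL p.1 (Pi.single p.2 1) := by
      simp [rowL, Pi.single_apply]
    have h2 : (Pi.single p.2 1 : Fin n → K) ∈
        ⨆ μ, Module.End.maxGenEigenspace (Matrix.toLin' A) μ := by
      rw [Module.End.iSup_maxGenEigenspace_eq_top]; trivial
    rw [h1]
    have h3 := Submodule.mem_map_of_mem (f := rowL p.1) h2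
    rw [Submodule.map_iSup] at h3
    refine (show (⨆ μ, Submodule.map (rowL p.1) (Module.End.maxGenEigenspace (Matrix.toLin' A) μ)) ≤ ⨆ μ, Gp A Y c μ from iSup_mono (fun μ => ?_)) h3
    rintro _ ⟨v, hv, rfl⟩
    rw [mem_Gp]
    have hv2 := hY μ v hv
    obtain ⟨k, hk⟩ := Module.End.mem_maxGenEigenspace _ _ _ |>.1 hv
    refine ⟨⟨k, ?_⟩, ?_⟩
    · have : ∀ (k : ℕ) (v : Fin n → K),
          (((D A).toLinearMap - μ • 1 : Module.End K (PR n K)) ^ k) (rowL p.1 v) =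
          rowL p.1 (((Matrix.toLin' A - μ • 1) ^ k) v) := by
        intro k
        induction k with
        | zero => intro v; simp
        | succ k ih =>
          intro v
          rw [pow_succ, pow_succ, Module.End.mul_apply, Module.End.mul_apply, ← ih]
          congr 1
          simp only [LinearMap.sub_apply, LinearMap.smul_apply, Module.End.one_apply,
            Derivation.coeFn_coe, D_rowL, map_sub, map_smul, Matrix.toLin'_apply]
      rw [this, hk, map_zero]
    · rw [D_rowL, hv2, map_smul]
  have htop : ∀ f : PR n K, f ∈ ⨆ μ, Gp A Y c μ := by
    intro f
    induction f using MvPolynomial.induction_on with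
    | C a =>
      apply Submodule.mem_iSup_of_mem 0
      rw [mem_Gp, hc0]
      have : ∀ B : Matrix (Fin n) (Fin n) K, D B (C a) = 0 := fun B => by
        rw [← MvPolynomial.algebraMap_eq, Derivation.map_algebraMap]
      refine ⟨⟨1, ?_⟩, ?_⟩
      · simp [this]
      · simp [this]
    | add f g hf hg => exact Submodule.add_mem _ hf hg
    | mul_X f p hf => exact hmul _ hf _ (hX p)
  intro f hf
  obtain ⟨F, hF, hsum⟩ := (Submodule.mem_iSup_iff_exists_finsupp _ _).1 (htop f)
  choose k hk using fun μ => (mem_Gp.1 (hF μ)).1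
  obtain ⟨q, hq⟩ := crt F.support (F.support.sup k) c
  have h1 : Polynomial.aeval ((D A).toLinearMap : Module.End K (PR n K)) q f = D Y f := by
    rw [← hsum, Finsupp.sum, map_sum, map_sum]
    refine Finset.sum_congr rfl fun μ hμ => ?_
    rw [(mem_Gp.1 (hF μ)).2]
    exact crt_apply _ (hq μ hμ) (pow_zero_of_le _ (Finset.le_sup hμ) (hk μ))
  rw [← h1]
  exact aeval_mem _ ((vI S).restrictScalars K) (fun v hv => hA v hv) q hf

lemma exists_replica [IsAlgClosed K] (A : Matrix (Fin n) (Fin n) K) (c : K → K) :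
    ∃ Y : Matrix (Fin n) (Fin n) K,
      ∀ μ, ∀ v ∈ Module.End.maxGenEigenspace (Matrix.toLin' A) μ, Y.mulVec v = c μ • v := by
  have hfin := WellFoundedGT.finite_ne_bot_of_iSupIndep
    (Module.End.independent_maxGenEigenspace (Matrix.toLin' A))
  obtain ⟨q, hq⟩ := crt hfin.toFinset (Module.finrank K (Fin n → K)) c
  refine ⟨Polynomial.aeval A q, ?_⟩
  · intro μ v hv
    by_cases h0 : Module.End.maxGenEigenspace (Matrix.toLin' A) μ = ⊥
    · rw [h0, Submodule.mem_bot] at hv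
      simp [hv]
    have := crt_apply (Matrix.toLin' A) (hq μ (by simpa using h0)) (v := v) (by
      rw [Module.End.maxGenEigenspace_eq_genEigenspace_finrank,
        Module.End.mem_genEigenspace_nat] at hv
      exact hv)
    rw [← this, ← Matrix.toLin'_apply]
    congr 1
    exact (Polynomial.aeval_algHom_apply (Matrix.toLinAlgEquiv' (R := K) (n := Fin n)).toAlgHom A q).symm

lemma tr_aux {V : Type*} [AddCommGroup V] [Module K V] [Module.Finite K V] {μ : K}
    (T R : V →ₗ[K] V) (h : R = T - μ • LinearMap.id) (h0 : LinearMap.trace K V R = 0) :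
    LinearMap.trace K V T = μ * (Module.finrank K V : K) := by
  rw [h, map_sub, map_smul, LinearMap.trace_id, sub_eq_zero] at h0
  rw [h0, smul_eq_mul]

lemma trace_replica [IsAlgClosed K] (A Y : Matrix (Fin n) (Fin n) K) (c : K → K)
    (hY : ∀ μ, ∀ v ∈ Module.End.maxGenEigenspace (Matrix.toLin' A) μ, Y.mulVec v = c μ • v) :
    ∃ s : Finset K, (∀ μ, Module.End.maxGenEigenspace (Matrix.toLin' A) μ ≠ ⊥ → μ ∈ s) ∧
      (A * Y).trace = ∑ μ ∈ s, c μ * μ * (Module.finrank K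
        (Module.End.maxGenEigenspace (Matrix.toLin' A) μ) : K) := by
  classical
  have hind := Module.End.independent_maxGenEigenspace (Matrix.toLin' A)
  have hfin := WellFoundedGT.finite_ne_bot_of_iSupIndep hind
  have hinternal : DirectSum.IsInternal
      (fun μ => Module.End.maxGenEigenspace (Matrix.toLin' A) μ) :=
    DirectSum.isInternal_submodule_iff_iSupIndep_and_iSup_eq_top _ |>.2
      ⟨hind, Module.End.iSup_maxGenEigenspace_eq_top _⟩
  have hAm : ∀ μ, Set.MapsTo (Matrix.toLin' A)
      (Module.End.maxGenEigenspace (Matrix.toLin' A) μ)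
      (Module.End.maxGenEigenspace (Matrix.toLin' A) μ) := fun μ =>
    Module.End.mapsTo_maxGenEigenspace_of_comm rfl μ
  have hAYv : ∀ μ, ∀ v ∈ Module.End.maxGenEigenspace (Matrix.toLin' A) μ,
      Matrix.toLin' (A * Y) v = c μ • Matrix.toLin' A v := by
    intro μ v hv
    rw [Matrix.toLin'_mul, LinearMap.comp_apply, Matrix.toLin'_apply Y, hY μ v hv, map_smul]
  have hAY : ∀ μ, Set.MapsTo (Matrix.toLin' (A * Y))
      (Module.End.maxGenEigenspace (Matrix.toLin' A) μ)
      (Module.End.maxGenEigenspace (Matrix.toLin' A) μ) := by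
    intro μ v hv
    rw [hAYv μ v hv]
    exact Submodule.smul_mem _ _ (hAm μ hv)
  refine ⟨hfin.toFinset, by intro μ h; simpa using h, ?_⟩
  rw [← Matrix.trace_toLin'_eq, LinearMap.trace_eq_sum_trace_restrict' hinternal hfin hAY]
  refine Finset.sum_congr rfl fun μ _ => ?_
  have e1 : (Matrix.toLin' (A * Y)).restrict (hAY μ) =
      c μ • (Matrix.toLin' A).restrict (hAm μ) := by
    ext v : 2
    exact hAYv μ v v.2
  have e2 : LinearMap.trace K _ ((Matrix.toLin' A).restrict (hAm μ)) =
      μ * (Module.finrank K (Module.End.maxGenEigenspace (Matrix.toLin' A) μ) : K) := by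
    have hnil := Module.End.isNilpotent_restrict_maxGenEigenspace_sub_algebraMap (Matrix.toLin' A) μ
    have h0 := (LinearMap.isNilpotent_trace_of_isNilpotent hnil).eq_zero
    have e3 : (Matrix.toLin' A - algebraMap K _ μ).restrict
        (Module.End.mapsTo_maxGenEigenspace_of_comm
          (Algebra.mul_sub_algebraMap_commutes (Matrix.toLin' A) μ) μ) =
        (Matrix.toLin' A).restrict (hAm μ) - μ • LinearMap.id := by
      ext v : 2
      rfl
    exact tr_aux _ _ e3 h0
  rw [e1, map_smul, e2, smul_eq_mul, mul_assoc]

/-- An element of the Lie algebra orthogonal to it is nilpotent. -/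
lemma nilp_of_orth [IsAlgClosed K] [CharZero K] {S : Set (GL (Fin n) K)}
    {A : Matrix (Fin n) (Fin n) K} (hA : A ∈ LieS S)
    (h : ∀ B ∈ LieS S, (A * B).trace = 0) : IsNilpotent A := by
  have key : ∀ μ, Module.End.maxGenEigenspace (Matrix.toLin' A) μ ≠ ⊥ → μ = 0 := by
    intro μ hμ
    rw [← Module.forall_dual_apply_eq_zero_iff ℚ]
    intro φ
    obtain ⟨Y, hY⟩ := exists_replica A (fun a => ((φ a : ℚ) : K))
    have hYS := replica_mem S hA _ (by intro a b; simp) hY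
    obtain ⟨s, hs, htr⟩ := trace_replica A Y _ hY
    rw [h Y hYS] at htr
    have h2 := congrArg φ htr
    have e : ∀ ν : K, ((φ ν : ℚ) : K) * ν * (Module.finrank K
        (Module.End.maxGenEigenspace (Matrix.toLin' A) ν) : K) = (φ ν * (Module.finrank K
        (Module.End.maxGenEigenspace (Matrix.toLin' A) ν) : ℚ)) • ν := by
      intro ν
      rw [Rat.smul_def]
      push_cast
      ring
    rw [map_zero, map_sum] at h2
    simp only [e, map_smul, smul_eq_mul] at h2
    have h3 := (Finset.sum_eq_zero_iff_of_nonneg (fun ν _ => by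
      have := mul_self_nonneg (φ ν)
      have h5 : (0:ℚ) ≤ (Module.finrank K
        (Module.End.maxGenEigenspace (Matrix.toLin' A) ν) : ℚ) := by positivity
      nlinarith [mul_nonneg this h5])).1 h2.symm μ (hs μ hμ)
    have h4 : (Module.finrank K (Module.End.maxGenEigenspace (Matrix.toLin' A) μ) : ℚ) ≠ 0 := by
      rw [Nat.cast_ne_zero]
      intro h0
      exact hμ (Submodule.finrank_eq_zero.1 h0)
    simpa [h4] using h3
  have htop : Module.End.maxGenEigenspace (Matrix.toLin' A) 0 = ⊤ := by
    rw [← top_le_iff, ← Module.End.iSup_maxGenEigenspace_eq_top (Matrix.toLin' A)]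
    refine iSup_le fun μ => ?_
    by_cases hμ : Module.End.maxGenEigenspace (Matrix.toLin' A) μ = ⊥
    · rw [hμ]; exact bot_le
    · rw [key μ hμ]
  refine ⟨Module.finrank K (Fin n → K), ?_⟩
  apply (Matrix.toLinAlgEquiv' (R := K) (n := Fin n)).injective
  rw [map_pow, map_zero]
  ext1 v
  ext1
  have hv : ∀ v : Fin n → K, v ∈ Module.End.maxGenEigenspace (Matrix.toLin' A) 0 := by
    rw [htop]; intro v; trivial
  rw [Module.End.maxGenEigenspace_eq_genEigenspace_finrank] at hv
  have h5 := Module.End.mem_genEigenspace_nat.1 (hv (Pi.single v 1))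
  rw [LinearMap.mem_ker, zero_smul, sub_zero] at h5
  have h6 : (Matrix.toLinAlgEquiv' (R := K) (n := Fin n) A) = Matrix.toLin' A := rfl
  rw [h6]
  simpa using h5

end replica

end NDec

namespace NDec

open MvPolynomial

section radical

open scoped MatrixGroups
variable {n : ℕ} {K : Type*} [Field K]

/-- the flag attached to a space of matrices -/
def Fl (r : Submodule K (Matrix (Fin n) (Fin n) K)) : ℕ → Submodule K (Fin n → K)
  | 0 => ⊤
  | i + 1 => Submodule.span K {v | ∃ x ∈ r, ∃ w ∈ Fl r i, v = Matrix.mulVec x w}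

lemma Fl_mem {r : Submodule K (Matrix (Fin n) (Fin n) K)} {x : Matrix (Fin n) (Fin n) K}
    (hx : x ∈ r) {i : ℕ} {w : Fin n → K} (hw : w ∈ Fl r i) : x.mulVec w ∈ Fl r (i + 1) :=
  Submodule.subset_span ⟨x, hx, w, hw, rfl⟩

lemma Fl_anti (r : Submodule K (Matrix (Fin n) (Fin n) K)) (i : ℕ) : Fl r (i + 1) ≤ Fl r i := by
  induction i with
  | zero => exact le_top
  | succ i ih =>
    conv_lhs => rw [Fl]
    rw [Submodule.span_le]
    rintro _ ⟨x, hx, w, hw, rfl⟩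
    exact Fl_mem hx (ih hw)

attribute [local instance] LieRing.ofAssociativeRing

lemma Fl_bot (r : Submodule K (Matrix (Fin n) (Fin n) K))
    (hlie : ∀ x ∈ r, ∀ y ∈ r, x * y - y * x ∈ r) (hnil : ∀ x ∈ r, IsNilpotent x) :
    ∃ k, Fl r k = ⊥ := by
  let e := (Matrix.toLinAlgEquiv' (R := K) (n := Fin n))
  let L : LieSubalgebra K (Module.End K (Fin n → K)) :=
    { r.map e.toLinearMap with
      lie_mem' := by
        rintro _ _ ⟨x, hx, rfl⟩ ⟨y, hy, rfl⟩
        refine ⟨x * y - y * x, hlie x hx y hy, ?_⟩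
        rw [LieRing.of_associative_ring_bracket]
        simp }
  have h1 : LieModule.IsNilpotent L (Fin n → K) := by
    rw [LieModule.isNilpotent_iff_forall (R := K)]
    rintro ⟨_, ⟨x, hx, rfl⟩⟩
    have h2 := (hnil x hx).map e
    exact h2
  obtain ⟨k, hk⟩ := (LieModule.isNilpotent_iff K L (Fin n → K)).1 h1
  refine ⟨k, ?_⟩
  have h3 : ∀ i, ∀ v ∈ Fl r i, v ∈ LieModule.lowerCentralSeries K L (Fin n → K) i := by
    intro i
    induction i with
    | zero => intro v _; simp
    | succ i ih =>
      intro v hv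
      rw [Fl] at hv
      induction hv using Submodule.span_induction with
      | zero => exact zero_mem _
      | add a b _ _ ha hb => exact add_mem ha hb
      | smul c a _ ha => exact (LieModule.lowerCentralSeries K L (Fin n → K) (i+1)).smul_mem c ha
      | mem v hv =>
        obtain ⟨x, hx, w, hw, rfl⟩ := hv
        rw [LieModule.lowerCentralSeries_succ]
        exact LieSubmodule.lie_mem_lie (x := (⟨e x, ⟨x, hx, rfl⟩⟩ : L)) (LieSubmodule.mem_top _) (ih w hw)
  rw [eq_bot_iff]
  intro v hv
  have := h3 k v hv
  rw [hk] at this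
  simpa using this

/-- strictly lowering matrices -/
def FW (r : Submodule K (Matrix (Fin n) (Fin n) K)) : Submodule K (Matrix (Fin n) (Fin n) K) where
  carrier := {Z | ∀ i, ∀ v ∈ Fl r i, Z.mulVec v ∈ Fl r (i + 1)}
  add_mem' := by
    intro a b ha hb i v hv
    rw [Matrix.add_mulVec]
    exact add_mem (ha i v hv) (hb i v hv)
  zero_mem' := by intro i v _; simp
  smul_mem' := by
    intro c a ha i v hv
    rw [Matrix.smul_mulVec]
    exact Submodule.smul_mem _ _ (ha i v hv)

lemma FW_mul {r : Submodule K (Matrix (Fin n) (Fin n) K)} {a b : Matrix (Fin n) (Fin n) K}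
    (ha : a ∈ FW r) (hb : b ∈ FW r) : a * b ∈ FW r := by
  intro i v hv
  rw [← Matrix.mulVec_mulVec]
  exact Fl_anti _ _ (ha _ _ (hb i v hv))

lemma FW_pow {r : Submodule K (Matrix (Fin n) (Fin n) K)} {a : Matrix (Fin n) (Fin n) K}
    (ha : a ∈ FW r) (k : ℕ) : a ^ (k + 1) ∈ FW r := by
  induction k with
  | zero => simpa
  | succ k ih => rw [pow_succ]; exact FW_mul ih ha

lemma FW_nil {r : Submodule K (Matrix (Fin n) (Fin n) K)} {k : ℕ} (hk : Fl r k = ⊥)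
    {a : Matrix (Fin n) (Fin n) K} (ha : a ∈ FW r) : IsNilpotent a := by
  have h : ∀ i, ∀ v : Fin n → K, (a ^ i).mulVec v ∈ Fl r i := by
    intro i
    induction i with
    | zero => intro v; trivial
    | succ i ih => intro v; rw [pow_succ', ← Matrix.mulVec_mulVec]; exact ha _ _ (ih v)
  refine ⟨k, ?_⟩
  apply Matrix.toLin'.injective
  ext1 v
  ext1
  have := h k (Pi.single v 1)
  rw [hk, Submodule.mem_bot] at this
  simpa [-Matrix.mulVec_single_one, -Matrix.toLin'_pow] using this

lemma nil_pow {a : Matrix (Fin n) (Fin n) K} (ha : IsNilpotent a) : a ^ n = 0 := by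
  have h := (Matrix.isNilpotent_charpoly_sub_pow_of_isNilpotent ha).eq_zero
  rw [sub_eq_zero] at h
  have h2 := Matrix.aeval_self_charpoly a
  rw [h] at h2
  simpa using h2

lemma exp_form (a : Matrix (Fin n) (Fin n) K) (m : ℕ) : ∃ Q, Commute a Q ∧
    ∑ k ∈ Finset.range (m + 2), (k.factorial : K)⁻¹ • a ^ k = 1 + a * (1 + a * Q) := by
  refine ⟨∑ k ∈ Finset.range m, ((k + 2).factorial : K)⁻¹ • a ^ k, ?_, ?_⟩
  · apply Commute.sum_right
    intro k _
    exact ((Commute.refl a).pow_right k).smul_right _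
  · rw [Finset.sum_range_succ', Finset.sum_range_succ']
    simp only [zero_add, Nat.factorial_zero, Nat.factorial_one, Nat.cast_one, inv_one, one_smul,
      pow_zero, pow_one, mul_add, mul_one, Finset.mul_sum, mul_smul_comm]
    rw [add_comm, add_comm (∑ k ∈ _, _)]
    congr 2
    refine Finset.sum_congr rfl fun k _ => ?_
    rw [pow_succ', pow_succ']

lemma r_zero [IsAlgClosed K] [CharZero K] {H M : Subgroup (GL (Fin n) K)}
    (hH : IsZClosed (H : Set (GL (Fin n) K))) (hred : IsReductiveSub H)
    (hMc : IsZClosed (M : Set (GL (Fin n) K))) (hM : NormalIn M H)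
    {a : Matrix (Fin n) (Fin n) K} (ha : a ∈ LieS (M : Set (GL (Fin n) K)))
    (ha' : ∀ b ∈ LieS (M : Set (GL (Fin n) K)), (a * b).trace = 0) : a = 0 := by
  let r : Submodule K (Matrix (Fin n) (Fin n) K) :=
    { carrier := {x | x ∈ LieS (M : Set (GL (Fin n) K)) ∧
        ∀ b ∈ LieS (M : Set (GL (Fin n) K)), (x * b).trace = 0}
      add_mem' := by
        rintro x y ⟨hx, hx'⟩ ⟨hy, hy'⟩
        refine ⟨add_mem hx hy, fun b hb => ?_⟩
        rw [add_mul, Matrix.trace_add, hx' b hb, hy' b hb, add_zero]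
      zero_mem' := ⟨zero_mem _, by simp⟩
      smul_mem' := by
        rintro c x ⟨hx, hx'⟩
        refine ⟨Submodule.smul_mem _ _ hx, fun b hb => ?_⟩
        rw [smul_mul_assoc, Matrix.trace_smul, hx' b hb, smul_zero] }
  have hlie : ∀ x ∈ r, ∀ y ∈ r, x * y - y * x ∈ r := by
    rintro x ⟨hx, hx'⟩ y ⟨hy, hy'⟩
    refine ⟨lie_mem_LieS hx hy, fun b hb => ?_⟩
    have h1 := hx' _ (lie_mem_LieS hy hb)
    rw [mul_sub, Matrix.trace_sub] at h1
    rw [sub_mul, Matrix.trace_sub, ← h1, mul_assoc, ← mul_assoc x b y,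
      Matrix.trace_mul_comm (x * b) y, mul_assoc y x b]
  have hnil : ∀ x ∈ r, IsNilpotent x := fun x hx => nilp_of_orth hx.1 hx.2
  obtain ⟨k, hk⟩ := Fl_bot r hlie hnil
  have hinv : ∀ h : GL (Fin n) K,
      (h : Matrix (Fin n) (Fin n) K) * (h⁻¹ : GL (Fin n) K) = 1 := by
    intro h; rw [← Units.val_mul]; simp
  have hinv' : ∀ h : GL (Fin n) K,
      ((h⁻¹ : GL (Fin n) K) : Matrix (Fin n) (Fin n) K) * h = 1 := by
    intro h; rw [← Units.val_mul]; simp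
  have hMH : ∀ h ∈ H, ∀ x ∈ LieS (M : Set (GL (Fin n) K)),
      (h : Matrix (Fin n) (Fin n) K) * x * (h⁻¹ : GL (Fin n) K) ∈ LieS (M : Set (GL (Fin n) K)) := by
    intro h hh x hx
    refine conj_mem_LieS (fun g hg => hM.2 h hh g hg) (fun g hg => ?_) hx
    simpa using hM.2 h⁻¹ (inv_mem hh) g hg
  have hrH : ∀ h ∈ H, ∀ x ∈ r,
      (h : Matrix (Fin n) (Fin n) K) * x * (h⁻¹ : GL (Fin n) K) ∈ r := by
    rintro h hh x ⟨hx, hx'⟩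
    refine ⟨hMH h hh x hx, fun b hb => ?_⟩
    have h1 := hx' _ (hMH h⁻¹ (inv_mem hh) b hb)
    rw [inv_inv] at h1
    rw [← h1, mul_assoc, Matrix.trace_mul_comm, ← mul_assoc, ← mul_assoc, Matrix.trace_mul_comm,
      ← mul_assoc]
  have hFH : ∀ h ∈ H, ∀ i, ∀ v ∈ Fl r i, (h : Matrix (Fin n) (Fin n) K).mulVec v ∈ Fl r i := by
    intro h hh i
    induction i with
    | zero => intro v _; trivial
    | succ i ih =>
      intro v hv
      rw [Fl] at hv
      induction hv using Submodule.span_induction with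
      | zero => simp
      | add a b _ _ ha hb => rw [Matrix.mulVec_add]; exact add_mem ha hb
      | smul c a _ ha => rw [Matrix.mulVec_smul]; exact Submodule.smul_mem _ _ ha
      | mem v hv =>
        obtain ⟨x, hx, w, hw, rfl⟩ := hv
        have e : (h : Matrix (Fin n) (Fin n) K).mulVec (x.mulVec w) =
            ((h : Matrix (Fin n) (Fin n) K) * x * (h⁻¹ : GL (Fin n) K)).mulVec
              ((h : Matrix (Fin n) (Fin n) K).mulVec w) := by
          rw [Matrix.mulVec_mulVec, Matrix.mulVec_mulVec, mul_assoc (_ * x), hinv', mul_one]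
        rw [e]
        exact Fl_mem (hrH h hh x hx) (ih w hw)
  have hWl : ∀ h ∈ H, ∀ z ∈ FW r, (h : Matrix (Fin n) (Fin n) K) * z ∈ FW r := by
    intro h hh z hz i v hv
    rw [← Matrix.mulVec_mulVec]
    exact hFH h hh _ _ (hz i v hv)
  have hWr : ∀ h ∈ H, ∀ z ∈ FW r, z * (h : Matrix (Fin n) (Fin n) K) ∈ FW r := by
    intro h hh z hz i v hv
    rw [← Matrix.mulVec_mulVec]
    exact hz i _ (hFH h hh _ _ hv)
  let U : Subgroup (GL (Fin n) K) :=
    { carrier := (H : Set (GL (Fin n) K)) ∩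
        {g : GL (Fin n) K | (g : Matrix (Fin n) (Fin n) K) - 1 ∈ FW r}
      mul_mem' := by
        rintro x y ⟨hx, hx'⟩ ⟨hy, hy'⟩
        refine ⟨mul_mem hx hy, ?_⟩
        have e : ((x * y : GL (Fin n) K) : Matrix (Fin n) (Fin n) K) - 1 =
          x * ((y : Matrix (Fin n) (Fin n) K) - 1) + (x - 1) := by
          rw [Units.val_mul, mul_sub, mul_one]; abel
        rw [Set.mem_setOf_eq, e]
        exact add_mem (hWl x hx _ hy') hx'
      one_mem' := ⟨one_mem _, by simp⟩
      inv_mem' := by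
        rintro x ⟨hx, hx'⟩
        refine ⟨inv_mem hx, ?_⟩
        have e : ((x⁻¹ : GL (Fin n) K) : Matrix (Fin n) (Fin n) K) - 1 =
          -(((x⁻¹ : GL (Fin n) K) : Matrix (Fin n) (Fin n) K) * (x - 1)) := by
          rw [mul_sub, mul_one, hinv']; abel
        rw [Set.mem_setOf_eq, e]
        exact neg_mem (hWl _ (inv_mem hx) _ hx') }
  have hU : U = ⊥ := by
    apply hred
    · refine ⟨fun x hx => hx.1, ?_⟩
      rintro h hh x ⟨hx, hx'⟩
      refine ⟨mul_mem (mul_mem hh hx) (inv_mem hh), ?_⟩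
      have e : ((h * x * h⁻¹ : GL (Fin n) K) : Matrix (Fin n) (Fin n) K) - 1 =
          h * ((x : Matrix (Fin n) (Fin n) K) - 1) * (h⁻¹ : GL (Fin n) K) := by
        rw [Units.val_mul, Units.val_mul, mul_sub, sub_mul, mul_one, hinv]
      rw [Set.mem_setOf_eq, e]
      exact hWr _ (inv_mem hh) _ (hWl h hh _ hx')
    · exact closed_inter hH (closed_linear _ _)
    · rintro g ⟨_, hg⟩
      exact nil_pow (FW_nil hk hg)
  have har : a ∈ r := ⟨ha, ha'⟩
  have haW : a ∈ FW r := fun i v hv => Fl_mem har hv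
  obtain ⟨m, hm⟩ := hnil a har
  obtain ⟨Q, hQ, hE⟩ := exp_form a m
  have hm2 : a ^ (m + 2) = 0 := by rw [pow_add, hm, zero_mul]
  have hc1 : Commute a (1 + a * Q) := (Commute.one_right a).add_right ((Commute.refl a).mul_right hQ)
  have hun : IsUnit (1 + a * (1 + a * Q)) :=
    (hc1.isNilpotent_mul_right ⟨m, hm⟩).isUnit_one_add
  have hun2 : IsUnit (1 + a * Q) := (hQ.isNilpotent_mul_right ⟨m, hm⟩).isUnit_one_add
  obtain ⟨g, hg⟩ := hun
  have hgM : g ∈ M := exp_mem hMc (one_mem M) ha (m + 2) hm2 g (by rw [hE, hg])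
  have hgU : g ∈ U := by
    refine ⟨hM.1 hgM, ?_⟩
    rw [Set.mem_setOf_eq, hg, ← hE, Finset.sum_range_succ']
    simp only [Nat.factorial_zero, Nat.cast_one, inv_one, one_smul, pow_zero, add_sub_cancel_right]
    exact Submodule.sum_mem _ fun k _ => Submodule.smul_mem _ _ (FW_pow haW k)
  rw [hU, Subgroup.mem_bot] at hgU
  rw [hgU, Units.val_one, left_eq_add] at hg
  obtain ⟨u, hu⟩ := hun2
  rw [← hu] at hg
  simpa using hg

end radical

end NDec

namespace NDec

open MvPolynomial

section centr

open scoped MatrixGroups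
universe u
variable {n : ℕ} {K : Type u} [Field K]

lemma nss [IsAlgClosed K] (J : Ideal (PR n K)) (f : PR n K)
    (h : ∀ x : Matrix (Fin n) (Fin n) K, (∀ p ∈ J, ev x p = 0) → ev x f = 0) : f ∈ J.radical := by
  rw [← MvPolynomial.vanishingIdeal_zeroLocus_eq_radical (K := K)]
  intro x hx
  exact h (Matrix.of fun i j => x (i, j)) hx

lemma LieS_mono {S T : Subgroup (GL (Fin n) K)} (h : S ≤ T) :
    LieS (S : Set (GL (Fin n) K)) ≤ LieS (T : Set (GL (Fin n) K)) := by
  intro A hA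
  rw [mem_LieS_iff] at hA ⊢
  intro f hf
  exact hA f (fun g hg => hf g (h hg))

lemma ev_ex_D [CharZero K] (A : Matrix (Fin n) (Fin n) K) :
    ∀ f : PR n K, ev (ex A) (D A f) = PowerSeries.derivative K (ev (ex A) f) := by
  apply der_comm
  intro p
  rw [D_X, ev_X, deriv_ex]
  have : ev (ex A) ((gm * cm A : Matrix (Fin n) (Fin n) (PR n K)) p.1 p.2) =
    ((gm * cm A : Matrix (Fin n) (Fin n) (PR n K)).map (ev (ex A))) p.1 p.2 := rfl
  rw [this, Matrix.map_mul]
  simp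

lemma ex_comm (A m : Matrix (Fin n) (Fin n) K) (h : A * m = m * A) :
    ex A * cm m = (cm m * ex A : Matrix (Fin n) (Fin n) (PowerSeries K)) := by
  ext i j k
  have hk : A ^ k * m = m * A ^ k := ((show Commute A m from h).pow_left k)
  rw [Matrix.mul_apply, Matrix.mul_apply, map_sum, map_sum]
  have h1 : ∀ l, PowerSeries.coeff k (ex A i l * (cm m : Matrix _ _ (PowerSeries K)) l j) =
      (k.factorial : K)⁻¹ * ((A ^ k) i l * m l j) := by
    intro l
    rw [cm_apply, PowerSeries.algebraMap_apply, Algebra.algebraMap_self, RingHom.id_apply, PowerSeries.coeff_mul_C, coeff_ex, mul_assoc]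
  have h2 : ∀ l, PowerSeries.coeff k ((cm m : Matrix _ _ (PowerSeries K)) i l * ex A l j) =
      (k.factorial : K)⁻¹ * (m i l * (A ^ k) l j) := by
    intro l
    rw [cm_apply, PowerSeries.algebraMap_apply, Algebra.algebraMap_self, RingHom.id_apply, PowerSeries.coeff_C_mul, coeff_ex, mul_left_comm]
  simp only [h1, h2, ← Finset.mul_sum]
  rw [← Matrix.mul_apply, ← Matrix.mul_apply, hk]

lemma det_gm_ev {R : Type*} [CommRing R] [Algebra K R] (g : Matrix (Fin n) (Fin n) R) :
    ev (K := K) g (gm : Matrix (Fin n) (Fin n) (PR n K)).det = g.det := by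
  rw [AlgHom.map_det, AlgHom.mapMatrix_apply, gm_map]

lemma mem_of_closed_mat {S : Set (GL (Fin n) K)} (hS : IsZClosed S) (x : Matrix (Fin n) (Fin n) K)
    (hx : x.det ≠ 0) (h : ∀ f ∈ vI S, ev x f = 0) :
    ∃ g ∈ S, (g : Matrix (Fin n) (Fin n) K) = x := by
  refine ⟨Matrix.GeneralLinearGroup.mkOfDetNeZero x hx, mem_of_closed hS _ ?_, rfl⟩
  exact h

/-- A Lie algebra element commuting with `M` is tangent to the centralizer. -/
lemma mem_LieS_centralizer [IsAlgClosed K] [CharZero K] {H M : Subgroup (GL (Fin n) K)}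
    (hH : IsZClosed (H : Set (GL (Fin n) K)))
    {X' : Matrix (Fin n) (Fin n) K} (hX : X' ∈ LieS (H : Set (GL (Fin n) K)))
    (hcomm : ∀ m ∈ M, X' * (m : Matrix (Fin n) (Fin n) K) = m * X') :
    X' ∈ LieS ((H ⊓ Subgroup.centralizer (M : Set (GL (Fin n) K)) : Subgroup (GL (Fin n) K)) :
      Set (GL (Fin n) K)) := by
  rw [mem_LieS_iff]
  intro f hf
  let E : Set (PR n K) := {q | ∃ m ∈ M, ∃ i j,
    q = (gm * cm (m : Matrix (Fin n) (Fin n) K) - cm (m : Matrix (Fin n) (Fin n) K) * gm :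
      Matrix (Fin n) (Fin n) (PR n K)) i j}
  have hE : ∀ (R : Type u) [CommRing R] [Algebra K R] (x : Matrix (Fin n) (Fin n) R)
      (m : Matrix (Fin n) (Fin n) K) (i j : Fin n),
      ev x ((gm * cm m - cm m * gm : Matrix (Fin n) (Fin n) (PR n K)) i j) =
        (x * cm m - cm m * x : Matrix (Fin n) (Fin n) R) i j := by
    intro R _ _ x m i j
    rw [Matrix.sub_apply, Matrix.sub_apply, map_sub]
    have e1 : ev x ((gm * cm m : Matrix (Fin n) (Fin n) (PR n K)) i j) =
      ((gm * cm m : Matrix (Fin n) (Fin n) (PR n K)).map (ev x)) i j := rfl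
    have e2 : ev x ((cm m * gm : Matrix (Fin n) (Fin n) (PR n K)) i j) =
      ((cm m * gm : Matrix (Fin n) (Fin n) (PR n K)).map (ev x)) i j := rfl
    rw [e1, e2, Matrix.map_mul, Matrix.map_mul]
    simp
  have h1 : (gm : Matrix (Fin n) (Fin n) (PR n K)).det * f ∈
      (vI (H : Set (GL (Fin n) K)) ⊔ Ideal.span E).radical := by
    apply nss
    intro x hx
    rw [map_mul, det_gm_ev]
    by_cases hd : x.det = 0
    · rw [hd, zero_mul]
    obtain ⟨g, hgH, rfl⟩ := mem_of_closed_mat hH x hd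
      (fun p hp => hx p (Ideal.mem_sup_left hp))
    have hgC : g ∈ Subgroup.centralizer (M : Set (GL (Fin n) K)) := by
      rw [Subgroup.mem_centralizer_iff]
      intro m hm
      apply Units.ext
      ext i j
      have := hx _ (Ideal.mem_sup_right (Ideal.subset_span ⟨m, hm, i, j, rfl⟩))
      rw [hE, Matrix.sub_apply, sub_eq_zero, cm_self] at this
      exact this.symm
    rw [hf g ⟨hgH, hgC⟩, mul_zero]
  obtain ⟨N, hN⟩ := h1
  have h2 : ∀ p ∈ vI (H : Set (GL (Fin n) K)) ⊔ Ideal.span E, ev (ex X') p = 0 := by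
    have : vI (H : Set (GL (Fin n) K)) ⊔ Ideal.span E ≤
        RingHom.ker (ev (ex X') : PR n K →ₐ[K] PowerSeries K) := by
      refine sup_le ?_ (Ideal.span_le.2 ?_)
      · intro p hp
        exact ev_ex _ (one_mem H) hX hp
      · rintro _ ⟨m, hm, i, j, rfl⟩
        rw [SetLike.mem_coe, RingHom.mem_ker, hE, ex_comm _ _ (hcomm m hm), sub_self]
        rfl
    exact this
  have h3 := h2 _ hN
  rw [map_pow, map_mul, det_gm_ev] at h3
  have h4 : ev (ex X') f = 0 :=
    (mul_eq_zero.1 (eq_zero_of_pow_eq_zero h3)).resolve_left (isUnit_det_ex X').ne_zero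
  have h5 := congrArg (cc K) (ev_ex_D X' f)
  rw [h4, map_ev, ex_cc] at h5
  simpa using h5

lemma lie_decomp [IsAlgClosed K] [CharZero K] {H M : Subgroup (GL (Fin n) K)}
    (hH : IsZClosed (H : Set (GL (Fin n) K))) (hred : IsReductiveSub H)
    (hMc : IsZClosed (M : Set (GL (Fin n) K))) (hM : NormalIn M H)
    {A : Matrix (Fin n) (Fin n) K} (hA : A ∈ LieS (H : Set (GL (Fin n) K))) :
    ∃ B ∈ LieS (M : Set (GL (Fin n) K)),
      ∃ Z ∈ LieS ((H ⊓ Subgroup.centralizer (M : Set (GL (Fin n) K)) : Subgroup (GL (Fin n) K)) :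
        Set (GL (Fin n) K)), A = B + Z := by
  let L := LieS (M : Set (GL (Fin n) K))
  let φ : Matrix (Fin n) (Fin n) K →ₗ[K] Module.Dual K L :=
    LinearMap.mk₂ K (fun a (b : L) => (a * (b : Matrix (Fin n) (Fin n) K)).trace)
      (by intros; simp [add_mul]) (by intros; simp) (by intros; simp [mul_add]) (by intros; simp)
  have hφ : ∀ a b, φ a b = (a * (b : Matrix (Fin n) (Fin n) K)).trace := fun a b => rfl
  have hinj : Function.Injective (φ.comp L.subtype) := by
    rw [injective_iff_map_eq_zero]
    intro a ha
    apply Subtype.ext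
    exact r_zero hH hred hMc hM a.2 (fun b hb => by
      have := LinearMap.congr_fun ha ⟨b, hb⟩
      exact this)
  have hsurj := (LinearMap.injective_iff_surjective_of_finrank_eq_finrank
    (Subspace.dual_finrank_eq (K := K) (V := L)).symm).1 hinj
  obtain ⟨B, hB⟩ := hsurj (φ A)
  refine ⟨B, B.2, A - B, ?_, by abel⟩
  have hX : A - (B : Matrix (Fin n) (Fin n) K) ∈ LieS (H : Set (GL (Fin n) K)) :=
    sub_mem hA (LieS_mono hM.1 B.2)
  have horth : ∀ b ∈ L, ((A - (B : Matrix (Fin n) (Fin n) K)) * b).trace = 0 := by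
    intro b hb
    have := LinearMap.congr_fun hB ⟨b, hb⟩
    rw [sub_mul, Matrix.trace_sub, sub_eq_zero]
    exact this.symm
  apply mem_LieS_centralizer hH hX
  intro m hm
  set Y := A - (B : Matrix (Fin n) (Fin n) K) with hYdef
  have h1 := ad_sub_mem hM hX hm
  have h2 := r_zero hH hred hMc hM h1 (fun b hb => by
    have h3 : ((m⁻¹ : GL (Fin n) K) : Matrix (Fin n) (Fin n) K) * b * m ∈ L := by
      have := conj_mem_LieS (S := (M : Set (GL (Fin n) K))) (h := m⁻¹) (A := b)
        (fun g hg => mul_mem (mul_mem (inv_mem hm) hg) (inv_mem (inv_mem hm)))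
        (fun g hg => mul_mem (mul_mem (inv_mem (inv_mem hm)) hg) (inv_mem hm)) hb
      rwa [inv_inv] at this
    have h4 := horth _ h3
    rw [sub_mul, Matrix.trace_sub, horth b hb, sub_zero, ← h4]
    rw [mul_assoc, mul_assoc, Matrix.trace_mul_comm, ← mul_assoc, ← mul_assoc, mul_assoc Y, mul_assoc Y])
  rw [sub_eq_zero] at h2
  have h5 : ((m⁻¹ : GL (Fin n) K) : Matrix (Fin n) (Fin n) K) * m = 1 := by
    rw [← Units.val_mul]; simp
  calc Y * (m : Matrix (Fin n) (Fin n) K) = (m * Y * (m⁻¹ : GL (Fin n) K)) * m := by rw [h2]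
    _ = m * Y := by rw [mul_assoc, h5, mul_one]

end centr

end NDec

namespace NDec

open MvPolynomial

section irred

open scoped MatrixGroups
universe u
variable {n : ℕ} {K : Type u} [Field K]

lemma lt_lt (a b : Matrix (Fin n) (Fin n) K) (f : PR n K) : lt a (lt b f) = lt (b * a) f := by
  rw [lt, lt, lt, map_ev, Matrix.map_mul, cm_map, gm_map, cm_mul, Matrix.mul_assoc]

lemma lt_one (f : PR n K) : lt (1 : Matrix (Fin n) (Fin n) K) f = f := by
  rw [lt, cm_one, Matrix.one_mul]
  have : (ev gm : PR n K →ₐ[K] PR n K) = AlgHom.id K _ := by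
    apply MvPolynomial.algHom_ext
    intro p
    simp
  rw [this]; rfl

lemma closed_biUnion {ι : Type*} {s : Set ι} (hs : s.Finite) (T : ι → Set (GL (Fin n) K))
    (h : ∀ i ∈ s, IsZClosed (T i)) : IsZClosed (⋃ i ∈ s, T i) := by
  induction s, hs using Set.Finite.induction_on with
  | empty => simpa using closed_empty
  | insert _ _ ih =>
    rw [Set.biUnion_insert]
    exact closed_union (h _ (Set.mem_insert _ _)) (ih fun i hi => h i (Set.mem_insert_of_mem _ hi))

lemma vI_prime [IsAlgClosed K] {H : Subgroup (GL (Fin n) K)}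
    (hH : IsZClosed (H : Set (GL (Fin n) K))) (hconn : IsZConnected (H : Set (GL (Fin n) K))) :
    (vI (H : Set (GL (Fin n) K))).IsPrime := by
  set I := vI (H : Set (GL (Fin n) K)) with hI
  have hne : I ≠ ⊤ := by
    rw [Ideal.ne_top_iff_one]
    intro h
    have := h 1 (one_mem H)
    simp at this
  obtain ⟨m, hm, hIm⟩ := Ideal.exists_le_maximal I hne
  have := hm.isPrime
  obtain ⟨p, hp, -⟩ := Ideal.exists_minimalPrimes_le hIm
  have hpp : p.IsPrime := hp.1.1
  have hcomapI : ∀ h ∈ H, I.comap (lt (h : Matrix (Fin n) (Fin n) K)).toRingHom = I := by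
    intro h hh
    ext f
    constructor
    · intro hf g hg
      have := hf (h⁻¹ * g) (mul_mem (inv_mem hh) hg)
      erw [ev_lt, ← Units.val_mul, mul_inv_cancel_left] at this
      exact this
    · intro hf
      exact lt_mem_vI hh hf
  have hsurj : ∀ h : GL (Fin n) K,
      Function.Surjective (lt (h : Matrix (Fin n) (Fin n) K)).toRingHom := by
    intro h f
    refine ⟨lt ((h⁻¹ : GL (Fin n) K) : Matrix (Fin n) (Fin n) K) f, ?_⟩
    have : lt (h : Matrix (Fin n) (Fin n) K) (lt ((h⁻¹ : GL (Fin n) K) :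
        Matrix (Fin n) (Fin n) K) f) = f := by
      rw [lt_lt, ← Units.val_mul, inv_mul_cancel, Units.val_one, lt_one]
    exact this
  have hmin : ∀ h ∈ H,
      p.comap (lt (h : Matrix (Fin n) (Fin n) K)).toRingHom ∈ I.minimalPrimes := by
    intro h hh
    have := Ideal.minimalPrimes_comap_of_surjective (hsurj h) hp
    rwa [hcomapI h hh] at this
  let T : Ideal (PR n K) → Set (GL (Fin n) K) := fun q =>
    {h | q ≤ p.comap (lt (h : Matrix (Fin n) (Fin n) K)).toRingHom}
  have hTc : ∀ q, IsZClosed (T q) := by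
    intro q
    apply closed_of _ {F | ∃ f ∈ q, ∃ z : Matrix (Fin n) (Fin n) K,
      (∀ g ∈ p, ev z g = 0) ∧ F = rt z f}
    intro g
    constructor
    · rintro hg _ ⟨f, hf, z, hz, rfl⟩
      rw [ev_rt, ← ev_lt]
      exact hz _ (hg hf)
    · intro hF f hf
      have : lt (g : Matrix (Fin n) (Fin n) K) f ∈ p.radical := by
        apply nss
        intro z hz
        have := hF _ ⟨f, hf, z, hz, rfl⟩
        rwa [ev_rt, ← ev_lt] at this
      rw [hpp.radical] at this
      exact this
  have hstab : ∀ h ∈ H, h ∈ T p := by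
    by_contra hcon
    push Not at hcon
    obtain ⟨h0, hh0, hh0'⟩ := hcon
    have hfin : (I.minimalPrimes \ {p}).Finite :=
      (Ideal.finite_minimalPrimes_of_isNoetherianRing _ I).subset Set.diff_subset
    have hcov : ∀ h ∈ H, ∃ q ∈ I.minimalPrimes, h ∈ T q := fun h hh =>
      ⟨_, hmin h hh, le_refl (p.comap (lt (h : Matrix (Fin n) (Fin n) K)).toRingHom)⟩
    have := hconn (T p) (⋃ q ∈ I.minimalPrimes \ {p}, T q) (hTc p)
      (closed_biUnion hfin _ fun q _ => hTc q) (by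
        intro h hh
        obtain ⟨q, hq, hhq⟩ := hcov h hh
        by_cases hqp : q = p
        · left; rw [← hqp]; exact hhq
        · right; exact Set.mem_biUnion (⟨hq, hqp⟩ : q ∈ I.minimalPrimes \ {p}) hhq)
      ⟨1, one_mem H, by
        intro f hf
        have : lt (1 : Matrix (Fin n) (Fin n) K) f ∈ p := by rwa [lt_one]
        exact this⟩
      ⟨h0, hh0, by
        obtain ⟨q, hq, hhq⟩ := hcov h0 hh0
        by_cases hqp : q = p
        · rw [hqp] at hhq; exact absurd hhq hh0'
        · exact Set.mem_biUnion (⟨hq, hqp⟩ : q ∈ I.minimalPrimes \ {p}) hhq⟩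
    obtain ⟨h, hh, h1, h2⟩ := this
    simp only [Set.mem_iUnion] at h2
    obtain ⟨q, ⟨hq, hqp⟩, h2⟩ := h2
    have e1 : p = p.comap (lt (h : Matrix (Fin n) (Fin n) K)).toRingHom :=
      le_antisymm h1 ((hmin h hh).2 hp.1 h1)
    have e2 : q = p.comap (lt (h : Matrix (Fin n) (Fin n) K)).toRingHom :=
      le_antisymm h2 ((hmin h hh).2 hq.1 h2)
    exact hqp (e2.trans e1.symm)
  have hdet : (gm : Matrix (Fin n) (Fin n) (PR n K)).det ∉ p := by
    intro hd
    obtain ⟨y, hy, hxy⟩ := Ideal.exists_mul_mem_of_mem_minimalPrimes hp hd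
    apply hy
    intro g hg
    have := hxy g hg
    rw [map_mul, det_gm_ev] at this
    exact (mul_eq_zero.1 this).resolve_left (by
      have := (Matrix.isUnit_iff_isUnit_det _).1 g.isUnit
      exact this.ne_zero)
  obtain ⟨z, hz, hzd⟩ : ∃ z : Matrix (Fin n) (Fin n) K, (∀ f ∈ p, ev z f = 0) ∧ z.det ≠ 0 := by
    by_contra hcon
    push Not at hcon
    apply hdet
    have h1 : (gm : Matrix (Fin n) (Fin n) (PR n K)).det ∈ p.radical := by
      apply nss
      intro z hz
      rw [det_gm_ev]
      exact hcon z hz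
    rwa [hpp.radical] at h1
  obtain ⟨g, hgH, rfl⟩ := mem_of_closed_mat hH z hzd (fun f hf => hz f (hp.1.2 hf))
  have hpI : p = I := by
    refine le_antisymm ?_ hp.1.2
    intro f hf h hh
    have h1 := hz _ (hstab (h * g⁻¹) (mul_mem hh (inv_mem hgH)) hf)
    erw [ev_lt, ← Units.val_mul, inv_mul_cancel_right] at h1
    exact h1
  rwa [← hpI]

end irred

end NDec

namespace NDec

open MvPolynomial

section density

open scoped MatrixGroups
universe u
variable {n : ℕ} {K : Type u} [Field K]

/-- the ideal of the identity -/
noncomputable def mx (n : ℕ) (K : Type u) [Field K] : Ideal (PR n K) :=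
  RingHom.ker (ev (1 : Matrix (Fin n) (Fin n) K) : PR n K →ₐ[K] K)

lemma mem_mx {f : PR n K} : f ∈ mx n K ↔ ev (1 : Matrix (Fin n) (Fin n) K) f = 0 := RingHom.mem_ker

/-- coordinates centered at the identity -/
noncomputable def yy (p : Fin n × Fin n) : PR n K := X p - C ((1 : Matrix (Fin n) (Fin n) K) p.1 p.2)

lemma ev_C' {R : Type*} [CommRing R] [Algebra K R] (g : Matrix (Fin n) (Fin n) R) (a : K) :
    ev g (C a : PR n K) = algebraMap K R a := by simp [ev]

lemma yy_mem (p : Fin n × Fin n) : (yy p : PR n K) ∈ mx n K := by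
  rw [mem_mx, yy, map_sub, ev_X, ev_C']; simp

/-- elementary matrices -/
noncomputable def EE (p : Fin n × Fin n) : Matrix (Fin n) (Fin n) K := Matrix.single p.1 p.2 1

lemma sum_EE (A : Matrix (Fin n) (Fin n) K) : A = ∑ p : Fin n × Fin n, A p.1 p.2 • EE p := by
  rw [Fintype.sum_prod_type]
  conv_lhs => rw [Matrix.matrix_eq_sum_single A]
  simp [EE, Matrix.smul_single]

/-- differential at the identity -/
noncomputable def dd (f : PR n K) : Module.Dual K (Matrix (Fin n) (Fin n) K) where
  toFun A := ev (1 : Matrix (Fin n) (Fin n) K) (D A f)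
  map_add' := by intro A B; rw [D_add]; simp
  map_smul' := by intro c A; rw [D_smul]; simp

lemma dd_apply (f : PR n K) (A : Matrix (Fin n) (Fin n) K) :
    dd f A = ev (1 : Matrix (Fin n) (Fin n) K) (D A f) := rfl

lemma dd_X (p : Fin n × Fin n) (A : Matrix (Fin n) (Fin n) K) :
    dd (X p : PR n K) A = A p.1 p.2 := by
  rw [dd_apply, D_X]
  have : ev (1 : Matrix (Fin n) (Fin n) K) ((gm * cm A : Matrix (Fin n) (Fin n) (PR n K)) p.1 p.2) =
    ((gm * cm A : Matrix (Fin n) (Fin n) (PR n K)).map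
      (ev (1 : Matrix (Fin n) (Fin n) K))) p.1 p.2 := rfl
  rw [this, Matrix.map_mul]
  simp

lemma dd_mul (f g : PR n K) (A : Matrix (Fin n) (Fin n) K) :
    dd (f * g) A = ev (1 : Matrix (Fin n) (Fin n) K) f * dd g A +
      ev (1 : Matrix (Fin n) (Fin n) K) g * dd f A := by
  simp [dd_apply]

lemma taylor (f : PR n K) : f - C (ev (1 : Matrix (Fin n) (Fin n) K) f) -
    ∑ p : Fin n × Fin n, C (dd f (EE p)) * yy p ∈ mx n K ^ 2 := by
  have h0 : ∀ f : PR n K, f - C (ev (1 : Matrix (Fin n) (Fin n) K) f) ∈ mx n K := by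
    intro f; rw [mem_mx, map_sub, ev_C']; simp
  induction f using MvPolynomial.induction_on with
  | C a =>
    have : ∀ A, dd (C a : PR n K) A = 0 := by
      intro A
      rw [dd_apply, ← MvPolynomial.algebraMap_eq, Derivation.map_algebraMap, map_zero]
    simp [this, ev_C']
  | add f g hf hg =>
    have := add_mem hf hg
    convert this using 1
    have h1 : ∀ A, dd (f + g) A = dd f A + dd g A := by intro A; simp [dd_apply]
    simp only [h1, map_add, add_mul, Finset.sum_add_distrib]
    ring
  | mul_X f q hf =>
    have hX : (X q : PR n K) - (C (ev (1 : Matrix (Fin n) (Fin n) K) (X q : PR n K)) : PR n K) -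
        ∑ p : Fin n × Fin n, C (dd (X q : PR n K) (EE p)) * yy p = 0 := by
      have : ∀ p : Fin n × Fin n, dd (X q : PR n K) (EE p) = if p = q then 1 else 0 := by
        intro p
        rw [dd_X, EE, Matrix.single_apply]
        simp [Prod.ext_iff]
      simp [this, yy]
    have h2 := Ideal.mul_mem_mul (h0 f) (h0 (X q))
    rw [← pow_two] at h2
    have h3 := add_mem h2 (Ideal.mul_mem_left _ (C (ev (1 : Matrix (Fin n) (Fin n) K) (X q : PR n K))) hf)
    convert h3 using 1
    simp only [dd_mul, map_add, map_mul, add_mul, Finset.sum_add_distrib, mul_assoc,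
      ← Finset.mul_sum]
    linear_combination (C (ev (1 : Matrix (Fin n) (Fin n) K) f)) * hX

/-- Euler operator -/
noncomputable def Eu (f : PR n K) : PR n K := ∑ p : Fin n × Fin n, yy p * D (EE p) f

lemma Eu_mul (f g : PR n K) : Eu (f * g) = f * Eu g + g * Eu f := by
  simp only [Eu, Derivation.leibniz, smul_eq_mul, mul_add, Finset.sum_add_distrib, Finset.mul_sum]
  congr 1 <;> exact Finset.sum_congr rfl fun p _ => by ring

lemma Eu_one (f : PR n K) (hf : f ∈ mx n K) : Eu f - f ∈ mx n K ^ 2 := by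
  have h := taylor f
  rw [mem_mx.1 hf, map_zero, sub_zero] at h
  have h2 : Eu f - ∑ p : Fin n × Fin n, C (dd f (EE p)) * yy p ∈ mx n K ^ 2 := by
    rw [Eu, ← Finset.sum_sub_distrib]
    refine Ideal.sum_mem _ fun p _ => ?_
    have : yy p * D (EE p) f - C (dd f (EE p)) * yy p =
      yy p * (D (EE p) f - C (dd f (EE p))) := by ring
    rw [this, pow_two]
    refine Ideal.mul_mem_mul (yy_mem p) ?_
    rw [mem_mx, map_sub, ev_C', dd_apply]
    simp
  have := sub_mem h2 h
  convert this using 1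
  ring

lemma Eu_pow (k : ℕ) : ∀ f ∈ mx n K ^ k, Eu f - (k : PR n K) * f ∈ mx n K ^ (k + 1) := by
  induction k with
  | zero =>
    intro f _
    simp only [Nat.cast_zero, zero_mul, sub_zero, zero_add, pow_one]
    exact Ideal.sum_mem _ fun p _ => Ideal.mul_mem_right _ _ (yy_mem p)
  | succ k ih =>
    intro f hf
    rw [pow_succ] at hf
    induction hf using Submodule.mul_induction_on' with
    | add x _ y _ hx hy =>
      have := add_mem hx hy
      convert this using 1
      simp only [Eu, map_add, mul_add, Finset.sum_add_distrib]
      ring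
    | mem_mul_mem a ha b hb =>
      have h1 := Ideal.mul_mem_mul ha (Eu_one b hb)
      have h2 := Ideal.mul_mem_mul (ih a ha) hb
      rw [← pow_add] at h1
      rw [← pow_succ] at h2
      have h3 := add_mem h1 h2
      convert h3 using 1
      rw [Eu_mul]
      push_cast
      ring

lemma D_pow (A : Matrix (Fin n) (Fin n) K) (k : ℕ) :
    ∀ f ∈ mx n K ^ (k + 1), D A f ∈ mx n K ^ k := by
  induction k with
  | zero => intro f _; simp
  | succ k ih =>
    intro f hf
    rw [pow_succ] at hf
    induction hf using Submodule.mul_induction_on' with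
    | add x _ y _ hx hy => rw [map_add]; exact add_mem hx hy
    | mem_mul_mem a ha b hb =>
      rw [Derivation.leibniz, smul_eq_mul, smul_eq_mul]
      refine add_mem (Ideal.mul_mem_right _ _ ha) ?_
      rw [pow_succ']
      exact Ideal.mul_mem_mul hb (ih a ha)

lemma lin_mem {H : Subgroup (GL (Fin n) K)} (l : Module.Dual K (Matrix (Fin n) (Fin n) K))
    (hl : ∀ A ∈ LieS (H : Set (GL (Fin n) K)), l A = 0) :
    ∑ p : Fin n × Fin n, C (l (EE p)) * (yy p : PR n K) ∈
      vI (H : Set (GL (Fin n) K)) ⊔ mx n K ^ 2 := by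
  let ψ : PR n K →ₗ[K] Module.Dual K (Matrix (Fin n) (Fin n) K) :=
    { toFun := dd
      map_add' := by intro f g; ext1 A; simp [dd_apply]
      map_smul' := by intro c f; ext1 A; simp [dd_apply] }
  let V := ((vI (H : Set (GL (Fin n) K))).restrictScalars K).map ψ
  have h1 : V.dualCoannihilator = LieS (H : Set (GL (Fin n) K)) := by
    ext A
    rw [Submodule.mem_dualCoannihilator, mem_LieS_iff]
    constructor
    · intro h f hf
      exact h _ ⟨f, hf, rfl⟩
    · rintro h _ ⟨f, hf, rfl⟩
      exact h f hf
  have h2 : l ∈ V := by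
    rw [← Subspace.dualCoannihilator_dualAnnihilator_eq (W := V), h1,
      Submodule.mem_dualAnnihilator]
    exact hl
  obtain ⟨f, hf, rfl⟩ := h2
  have h3 := taylor f
  have h4 : ev (1 : Matrix (Fin n) (Fin n) K) f = 0 := hf 1 (one_mem H)
  rw [h4, map_zero, sub_zero] at h3
  have h5 := sub_mem (Ideal.mem_sup_left hf : f ∈ vI (H : Set (GL (Fin n) K)) ⊔ mx n K ^ 2)
    (Ideal.mem_sup_right h3)
  convert h5 using 1
  rw [sub_sub_cancel]
  rfl

lemma step [CharZero K] {H : Subgroup (GL (Fin n) K)} (J : Ideal (PR n K))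
    (hJ : ∀ A ∈ LieS (H : Set (GL (Fin n) K)), ∀ f ∈ J, D A f ∈ J) (k : ℕ)
    (hk : J ≤ vI (H : Set (GL (Fin n) K)) ⊔ mx n K ^ (k + 1)) :
    J ≤ vI (H : Set (GL (Fin n) K)) ⊔ mx n K ^ (k + 2) := by
  intro f hf
  obtain ⟨i, hi, g, hg, rfl⟩ := Submodule.mem_sup.1 (hk hf)
  set I := vI (H : Set (GL (Fin n) K)) with hI
  have hDg : ∀ A ∈ LieS (H : Set (GL (Fin n) K)), D A g ∈ I ⊔ mx n K ^ (k + 1) := by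
    intro A hA
    have h1 := hk (hJ A hA _ hf)
    rw [map_add] at h1
    have h2 := sub_mem h1 (Ideal.mem_sup_left (hA i hi))
    rwa [add_sub_cancel_left] at h2
  have hmulsup : ∀ (a b : ℕ) (x y : PR n K), x ∈ I ⊔ mx n K ^ a → y ∈ I ⊔ mx n K ^ b →
      x * y ∈ I ⊔ mx n K ^ (a + b) := by
    intro a b x y hx hy
    obtain ⟨x1, hx1, x2, hx2, rfl⟩ := Submodule.mem_sup.1 hx
    obtain ⟨y1, hy1, y2, hy2, rfl⟩ := Submodule.mem_sup.1 hy
    have e : (x1 + x2) * (y1 + y2) = (x1 * (y1 + y2) + x2 * y1) + x2 * y2 := by ring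
    rw [e]
    refine add_mem (Ideal.mem_sup_left (add_mem (Ideal.mul_mem_right _ _ hx1)
      (Ideal.mul_mem_left _ _ hy1))) (Ideal.mem_sup_right ?_)
    rw [pow_add]
    exact Ideal.mul_mem_mul hx2 hy2
  obtain ⟨π, hπ⟩ : ∃ π : Matrix (Fin n) (Fin n) K →ₗ[K] Matrix (Fin n) (Fin n) K,
      (∀ A, π A ∈ LieS (H : Set (GL (Fin n) K))) ∧
      ∀ A ∈ LieS (H : Set (GL (Fin n) K)), π A = A := by
    obtain ⟨P, hP⟩ := (LieS (H : Set (GL (Fin n) K))).subtype.exists_leftInverse_of_injective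
      (Submodule.ker_subtype _)
    refine ⟨(LieS (H : Set (GL (Fin n) K))).subtype ∘ₗ P, fun A => (P A).2, fun A hA => ?_⟩
    exact congrArg Subtype.val (LinearMap.congr_fun hP ⟨A, hA⟩)
  have hEu : Eu g = ∑ p : Fin n × Fin n, yy p * D (π (EE p)) g +
      ∑ q : Fin n × Fin n, (∑ p : Fin n × Fin n, C ((EE p - π (EE p) : Matrix (Fin n) (Fin n) K) q.1 q.2) * yy p) *
        D (EE q) g := by
    have h1 : ∀ p : Fin n × Fin n, D (EE p) g = D (π (EE p)) g +
        ∑ q : Fin n × Fin n, C ((EE p - π (EE p) : Matrix (Fin n) (Fin n) K) q.1 q.2) * D (EE q) g := by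
      intro p
      have h2 : (EE p : Matrix (Fin n) (Fin n) K) = π (EE p) + (EE p - π (EE p)) := by abel
      conv_lhs => rw [h2, D_add]
      rw [Derivation.add_apply]
      congr 1
      conv_lhs => rw [sum_EE (EE p - π (EE p))]
      have h3 : ∀ (s : Finset (Fin n × Fin n)) (F : Fin n × Fin n → Matrix (Fin n) (Fin n) K),
          D (∑ q ∈ s, F q) g = ∑ q ∈ s, D (F q) g := by
        intro s F
        induction s using Finset.cons_induction with
        | empty =>
          have : D (0 : Matrix (Fin n) (Fin n) K) = 0 := by
            have := D_smul (0 : K) (0 : Matrix (Fin n) (Fin n) K)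
            rwa [zero_smul, zero_smul] at this
          simp [this]
        | cons a s ha ih => rw [Finset.sum_cons, Finset.sum_cons, D_add, Derivation.add_apply, ih]
      rw [h3]
      refine Finset.sum_congr rfl fun q _ => ?_
      rw [D_smul, Derivation.smul_apply, MvPolynomial.smul_eq_C_mul]
    rw [Eu]
    simp only [Finset.sum_mul]
    rw [Finset.sum_comm, ← Finset.sum_add_distrib]
    refine Finset.sum_congr rfl fun p _ => ?_
    conv_lhs => rw [h1 p, mul_add, Finset.mul_sum]
    congr 1
    exact Finset.sum_congr rfl fun q _ => by ring
  have hEu2 : Eu g ∈ I ⊔ mx n K ^ (k + 2) := by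
    rw [hEu]
    refine add_mem (Ideal.sum_mem _ fun p _ => ?_) (Ideal.sum_mem _ fun q _ => ?_)
    · have := hmulsup 1 (k + 1) _ _ (Ideal.mem_sup_right (by rw [pow_one]; exact yy_mem p))
        (hDg _ (hπ.1 (EE p)))
      rwa [add_comm 1] at this
    · let l : Module.Dual K (Matrix (Fin n) (Fin n) K) :=
        { toFun := fun A => (A - π A) q.1 q.2
          map_add' := by intro A B; simp; ring
          map_smul' := by intro c A; simp; ring }
      have h1 := lin_mem (H := H) l (fun A hA => by
        show (A - π A) q.1 q.2 = 0
        rw [hπ.2 A hA]; simp)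
      have := hmulsup 2 k _ _ h1 (Ideal.mem_sup_right (D_pow (EE q) k g hg))
      rwa [add_comm 2] at this
  have h1 := Eu_pow (k + 1) g hg
  have h2 : ((k + 1 : ℕ) : PR n K) * g ∈ I ⊔ mx n K ^ (k + 2) := by
    have := sub_mem hEu2 (Ideal.mem_sup_right h1)
    rwa [sub_sub_cancel] at this
  have h3 := Ideal.mul_mem_left _ (C (((k + 1 : ℕ) : K)⁻¹)) h2
  rw [← mul_assoc, ← map_natCast (C : K →+* PR n K) (k + 1), ← map_mul, inv_mul_cancel₀ (by
    exact_mod_cast Nat.succ_ne_zero k), map_one, one_mul] at h3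
  exact add_mem (Ideal.mem_sup_left hi) h3

lemma le_of_stable [CharZero K] {H : Subgroup (GL (Fin n) K)}
    (hprime : (vI (H : Set (GL (Fin n) K))).IsPrime) (J : Ideal (PR n K)) (hJ1 : J ≤ mx n K)
    (hJ : ∀ A ∈ LieS (H : Set (GL (Fin n) K)), ∀ f ∈ J, D A f ∈ J) :
    J ≤ vI (H : Set (GL (Fin n) K)) := by
  set I := vI (H : Set (GL (Fin n) K)) with hI
  have h1 : ∀ k, J ≤ I ⊔ mx n K ^ (k + 1) := by
    intro k
    induction k with
    | zero => rw [zero_add, pow_one]; exact hJ1.trans le_sup_right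
    | succ k ih => exact step J hJ k ih
  have hdom : IsDomain (PR n K ⧸ I) := Ideal.Quotient.isDomain I
  have hImx : I ≤ mx n K := fun f hf => hf 1 (one_mem H)
  have hne : (mx n K).map (Ideal.Quotient.mk I) ≠ ⊤ := by
    intro h
    have h2 := congrArg (Ideal.comap (Ideal.Quotient.mk I)) h
    rw [Ideal.comap_map_of_surjective _ Ideal.Quotient.mk_surjective, Ideal.comap_top] at h2
    have h3 : (1 : PR n K) ∈ mx n K := by
      have : (1 : PR n K) ∈ (⊤ : Ideal (PR n K)) := trivial
      rw [← h2] at this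
      have h4 : Ideal.comap (Ideal.Quotient.mk I) ⊥ = I := by
        rw [← RingHom.ker_eq_comap_bot, Ideal.mk_ker]
      rw [h4, sup_eq_left.2 hImx] at this
      exact this
    rw [mem_mx, map_one] at h3
    exact one_ne_zero h3
  have hK := Ideal.iInf_pow_eq_bot_of_isDomain _ hne
  intro f hf
  rw [← Ideal.Quotient.eq_zero_iff_mem, ← Ideal.mem_bot, ← hK, Ideal.mem_iInf]
  intro k
  have h5 := Ideal.mem_map_of_mem (Ideal.Quotient.mk I) (h1 k hf)
  rw [Ideal.map_sup, Ideal.map_quotient_self, bot_sup_eq, Ideal.map_pow] at h5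
  exact Ideal.pow_le_pow_right (Nat.le_succ k) h5

lemma dense [CharZero K] {H M C' : Subgroup (GL (Fin n) K)}
    (hprime : (vI (H : Set (GL (Fin n) K))).IsPrime)
    (hcomm : ∀ m ∈ M, ∀ c ∈ C', m * c = c * m)
    (hdec : ∀ A ∈ LieS (H : Set (GL (Fin n) K)), ∃ B ∈ LieS (M : Set (GL (Fin n) K)),
      ∃ Z ∈ LieS (C' : Set (GL (Fin n) K)), A = B + Z)
    (f : PR n K) (hf : ∀ m ∈ M, ∀ c ∈ C', ev ((m * c : GL (Fin n) K) : Matrix (Fin n) (Fin n) K) f = 0) :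
    f ∈ vI (H : Set (GL (Fin n) K)) := by
  let S : Set (GL (Fin n) K) := {g | ∃ m ∈ M, ∃ c ∈ C', g = m * c}
  have hS : f ∈ vI S := by
    rintro _ ⟨m, hm, c, hc, rfl⟩
    exact hf m hm c hc
  refine le_of_stable hprime (vI S) (fun f hf => hf 1 ⟨1, one_mem _, 1, one_mem _, by simp⟩) ?_ hS
  intro A hA f hf
  obtain ⟨B, hB, Z, hZ, rfl⟩ := hdec A hA
  rw [D_add, Derivation.add_apply]
  apply add_mem
  · rintro _ ⟨m, hm, c, hc, rfl⟩
    rw [hcomm m hm c hc, Units.val_mul, ← ev_lt, lt_D]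
    refine hB _ ?_ m hm
    intro g hg
    rw [ev_lt, ← Units.val_mul, ← hcomm g hg c hc]
    exact hf _ ⟨g, hg, c, hc, rfl⟩
  · rintro _ ⟨m, hm, c, hc, rfl⟩
    rw [Units.val_mul, ← ev_lt, lt_D]
    refine hZ _ ?_ c hc
    intro g hg
    rw [ev_lt, ← Units.val_mul]
    exact hf _ ⟨m, hm, g, hg, rfl⟩

end density

end NDec

namespace NDec

open MvPolynomial

section chevalley

open scoped MatrixGroups
universe u
variable {n : ℕ} {K : Type u} [Field K]

/-- coordinates on pairs of matrices -/
abbrev TR (n : ℕ) (K : Type u) [Field K] := MvPolynomial ((Fin n × Fin n) ⊕ (Fin n × Fin n)) K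

/-- evaluation at a pair of matrices -/
noncomputable def ev2 (y z : Matrix (Fin n) (Fin n) K) : TR n K →ₐ[K] K :=
  aeval (Sum.elim (fun p => y p.1 p.2) (fun p => z p.1 p.2))

noncomputable def YY : Matrix (Fin n) (Fin n) (TR n K) := Matrix.of fun i j => X (Sum.inl (i, j))
noncomputable def ZZ : Matrix (Fin n) (Fin n) (TR n K) := Matrix.of fun i j => X (Sum.inr (i, j))

lemma YY_map (y z : Matrix (Fin n) (Fin n) K) : (YY : Matrix (Fin n) (Fin n) (TR n K)).map (ev2 y z) = y := by
  ext i j; simp [YY, ev2]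

lemma ZZ_map (y z : Matrix (Fin n) (Fin n) K) : (ZZ : Matrix (Fin n) (Fin n) (TR n K)).map (ev2 y z) = z := by
  ext i j; simp [ZZ, ev2]

/-- functions vanishing on a product -/
noncomputable def vJ (M C' : Subgroup (GL (Fin n) K)) : Ideal (TR n K) where
  carrier := {t | ∀ m ∈ M, ∀ c ∈ C', ev2 (m : Matrix (Fin n) (Fin n) K) (c : Matrix (Fin n) (Fin n) K) t = 0}
  add_mem' := by intro a b ha hb m hm c hc; rw [map_add, ha m hm c hc, hb m hm c hc, add_zero]
  zero_mem' := by intro m _ c _; simp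
  smul_mem' := by intro r a ha m hm c hc; rw [smul_eq_mul, map_mul, ha m hm c hc, mul_zero]

lemma mem_vJ {M C' : Subgroup (GL (Fin n) K)} {t : TR n K} : t ∈ vJ M C' ↔
    ∀ m ∈ M, ∀ c ∈ C', ev2 (m : Matrix (Fin n) (Fin n) K) (c : Matrix (Fin n) (Fin n) K) t = 0 := Iff.rfl

/-- the product map on coordinate rings -/
noncomputable def psi (M C' : Subgroup (GL (Fin n) K)) : PR n K →ₐ[K] (TR n K ⧸ vJ M C') :=
  (Ideal.Quotient.mkₐ K (vJ M C')).comp (ev (YY * ZZ))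

lemma ev2_prod (y z : Matrix (Fin n) (Fin n) K) (f : PR n K) :
    ev2 y z (ev (YY * ZZ) f) = ev (y * z) f := by
  rw [map_ev, Matrix.map_mul, YY_map, ZZ_map]

lemma psi_fp (M C' : Subgroup (GL (Fin n) K)) :
    (psi M C' : PR n K →+* (TR n K ⧸ vJ M C')).FinitePresentation := by
  rw [← RingHom.FinitePresentation.of_finiteType]
  apply RingHom.FiniteType.of_comp_finiteType (f := algebraMap K (PR n K))
  have : (psi M C' : PR n K →+* (TR n K ⧸ vJ M C')).comp (algebraMap K (PR n K)) =
    algebraMap K (TR n K ⧸ vJ M C') := (psi M C').comp_algebraMap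
  rw [this, RingHom.finiteType_algebraMap]
  infer_instance

lemma image_open [IsAlgClosed K] {H M C' : Subgroup (GL (Fin n) K)}
    (hprime : (vI (H : Set (GL (Fin n) K))).IsPrime)
    (hMH : M ≤ H) (hCH : C' ≤ H)
    (hMc : IsZClosed (M : Set (GL (Fin n) K))) (hCc : IsZClosed (C' : Set (GL (Fin n) K)))
    (hden : ∀ f : PR n K, (∀ m ∈ M, ∀ c ∈ C',
      ev ((m * c : GL (Fin n) K) : Matrix (Fin n) (Fin n) K) f = 0) → f ∈ vI (H : Set (GL (Fin n) K))) :
    ∃ s : PR n K, s ∉ vI (H : Set (GL (Fin n) K)) ∧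
      ∀ x ∈ H, ev (x : Matrix (Fin n) (Fin n) K) s ≠ 0 → ∃ m ∈ M, ∃ c ∈ C', x = m * c := by
  set I := vI (H : Set (GL (Fin n) K)) with hI
  let ψ : PR n K →+* (TR n K ⧸ vJ M C') := psi M C'
  have hmk : ∀ f, ψ f = Ideal.Quotient.mk (vJ M C') (ev (YY * ZZ) f) := fun f => rfl
  have hker : RingHom.ker ψ = I := by
    ext f
    rw [RingHom.mem_ker, hmk, Ideal.Quotient.eq_zero_iff_mem, mem_vJ]
    simp only [ev2_prod]
    constructor
    · intro h
      exact hden f h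
    · intro h m hm c hc
      exact h (m * c) (mul_mem (hMH hm) (hCH hc))
  obtain ⟨S, hS⟩ := PrimeSpectrum.exists_constructibleSetData_iff.2
    (PrimeSpectrum.isConstructible_range_comap (psi_fp M C'))
  have hIr : (⟨I, hprime⟩ : PrimeSpectrum (PR n K)) ∈ Set.range (PrimeSpectrum.comap ψ) := by
    obtain ⟨p', hp', _, h⟩ := Ideal.exists_comap_eq_of_mem_minimalPrimes (I := ⊥) ψ I (by
      rw [← RingHom.ker_eq_comap_bot, hker, Ideal.minimalPrimes_eq_subsingleton_self]
      rfl)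
    exact ⟨⟨p', hp'⟩, PrimeSpectrum.ext h⟩
  have hIr2 := hIr
  change _ ∈ Set.range (PrimeSpectrum.comap (psi M C' : PR n K →+* (TR n K ⧸ vJ M C'))) at hIr2
  rw [← hS, PrimeSpectrum.ConstructibleSetData.toSet, Set.mem_iUnion₂] at hIr2
  obtain ⟨B, hB, hg, hf⟩ := hIr2
  rw [PrimeSpectrum.mem_zeroLocus] at hg hf
  refine ⟨B.f, fun h => hf (by simpa using h), ?_⟩
  intro x hx hxs
  let ex : PR n K →ₐ[K] K := ev (x : Matrix (Fin n) (Fin n) K)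
  have hmax : (RingHom.ker ex).IsMaximal := by
    apply RingHom.ker_isMaximal_of_surjective
    intro a
    exact ⟨C a, by simp [ex, ev]⟩
  have hxr : (⟨RingHom.ker ex, hmax.isPrime⟩ : PrimeSpectrum (PR n K)) ∈
      Set.range (PrimeSpectrum.comap (psi M C' : PR n K →+* (TR n K ⧸ vJ M C'))) := by
    rw [← hS, PrimeSpectrum.ConstructibleSetData.toSet, Set.mem_iUnion₂]
    refine ⟨B, hB, ?_, ?_⟩
    · rw [PrimeSpectrum.mem_zeroLocus]
      intro g hgg
      exact (hg hgg : g ∈ I) x hx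
    · rw [PrimeSpectrum.mem_zeroLocus]
      intro h
      exact hxs (h rfl)
  obtain ⟨Q, hQ⟩ := hxr
  have hQ2 : Ideal.comap ψ Q.asIdeal = RingHom.ker ex := congrArg PrimeSpectrum.asIdeal hQ
  obtain ⟨Q', hQ', hle⟩ := Ideal.exists_le_maximal Q.asIdeal Q.2.ne_top
  have hQm : RingHom.ker ex ≤ Ideal.comap ψ Q' := by
    rw [← hQ2]; exact Ideal.comap_mono hle
  have hmaxT : (Ideal.comap (Ideal.Quotient.mk (vJ M C')) Q').IsMaximal :=
    Ideal.comap_isMaximal_of_surjective _ Ideal.Quotient.mk_surjective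
  obtain ⟨w, hw⟩ := MvPolynomial.isMaximal_iff_eq_vanishingIdeal_singleton.1 hmaxT
  let y : Matrix (Fin n) (Fin n) K := Matrix.of fun i j => w (Sum.inl (i, j))
  let z : Matrix (Fin n) (Fin n) K := Matrix.of fun i j => w (Sum.inr (i, j))
  have hev : ∀ t : TR n K, ev2 y z t = aeval w t := by
    intro t
    rw [ev2]
    congr 2
    ext p
    rcases p with p | p <;> rfl
  have hmemT : ∀ t : TR n K, Ideal.Quotient.mk (vJ M C') t ∈ Q' ↔ ev2 y z t = 0 := by
    intro t
    rw [hev, ← MvPolynomial.mem_vanishingIdeal_singleton_iff, ← hw, Ideal.mem_comap]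
  have hJ : ∀ t ∈ vJ M C', ev2 y z t = 0 := by
    intro t ht
    rw [← hmemT, Ideal.Quotient.eq_zero_iff_mem.2 ht]
    exact zero_mem _
  have hyz : y * z = (x : Matrix (Fin n) (Fin n) K) := by
    ext i j
    have h1 : (X (i, j) - C ((x : Matrix (Fin n) (Fin n) K) i j) : PR n K) ∈ RingHom.ker ex := by
      rw [RingHom.mem_ker]; simp [ex, ev]
    have h2 := hQm h1
    rw [Ideal.mem_comap, hmk, hmemT, ev2_prod, map_sub, ev_X, ev_C', sub_eq_zero] at h2
    exact h2
  have hdet : y.det * z.det ≠ 0 := by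
    rw [← Matrix.det_mul, hyz]
    exact (x.isUnit.map Matrix.detMonoidHom).ne_zero
  obtain ⟨m, hm, hmy⟩ := mem_of_closed_mat hMc y (left_ne_zero_of_mul hdet) (by
    intro f hf
    have h := hJ (ev YY f) (by
      intro m hm c hc
      rw [map_ev, YY_map]; exact hf m hm)
    rwa [map_ev, YY_map] at h)
  obtain ⟨c, hc, hcz⟩ := mem_of_closed_mat hCc z (right_ne_zero_of_mul hdet) (by
    intro f hf
    have h := hJ (ev ZZ f) (by
      intro m hm c hc
      rw [map_ev, ZZ_map]; exact hf c hc)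
    rwa [map_ev, ZZ_map] at h)
  refine ⟨m, hm, c, hc, Units.ext ?_⟩
  rw [Units.val_mul, hmy, hcz, hyz]

lemma closed_centralizer (S : Set (GL (Fin n) K)) :
    IsZClosed (Subgroup.centralizer S : Set (GL (Fin n) K)) := by
  let W : Submodule K (Matrix (Fin n) (Fin n) K) :=
    { carrier := {A | ∀ s ∈ S, (s : Matrix (Fin n) (Fin n) K) * A = A * (s : Matrix (Fin n) (Fin n) K)}
      add_mem' := by intro a b ha hb s hs; rw [mul_add, add_mul, ha s hs, hb s hs]
      zero_mem' := by intro s _; simp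
      smul_mem' := by intro c a ha s hs; rw [mul_smul_comm, smul_mul_assoc, ha s hs] }
  have h := closed_linear W 0
  convert h using 1
  ext g
  simp only [sub_zero, SetLike.mem_coe, Set.mem_setOf_eq, Subgroup.mem_centralizer_iff]
  refine forall₂_congr fun s hs => ?_
  rw [← Units.val_inj, Units.val_mul, Units.val_mul]

/-- Key lemma -/
lemma key [IsAlgClosed K] [CharZero K] {H M : Subgroup (GL (Fin n) K)}
    (hH : IsZClosed (H : Set (GL (Fin n) K))) (hconn : IsZConnected (H : Set (GL (Fin n) K)))
    (hred : IsReductiveSub H)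
    (hMc : IsZClosed (M : Set (GL (Fin n) K))) (hM : NormalIn M H) :
    ∀ h ∈ H, ∃ m ∈ M, ∃ c ∈ H ⊓ Subgroup.centralizer (M : Set (GL (Fin n) K)), h = m * c := by
  have hprime := vI_prime hH hconn
  have hcomm : ∀ m ∈ M, ∀ c ∈ H ⊓ Subgroup.centralizer (M : Set (GL (Fin n) K)), m * c = c * m :=
    fun m hm c hc => Subgroup.mem_centralizer_iff.1 hc.2 m hm
  obtain ⟨s, hs, hopen⟩ := image_open hprime hM.1
    (inf_le_left : H ⊓ Subgroup.centralizer (M : Set (GL (Fin n) K)) ≤ H) hMc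
    (closed_inter hH (closed_centralizer _))
    (dense hprime hcomm fun A hA => lie_decomp hH hred hMc hM hA)
  intro x hx
  have hs2 : lt ((x⁻¹ : GL (Fin n) K) : Matrix (Fin n) (Fin n) K) s ∉ vI (H : Set (GL (Fin n) K)) := by
    intro h
    apply hs
    have := lt_mem_vI hx h
    rwa [lt_lt, ← Units.val_mul, inv_mul_cancel, Units.val_one, lt_one] at this
  have h3 : s * lt ((x⁻¹ : GL (Fin n) K) : Matrix (Fin n) (Fin n) K) s ∉ vI (H : Set (GL (Fin n) K)) :=
    fun h => (hprime.mem_or_mem h).elim hs hs2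
  rw [mem_vI] at h3
  push Not at h3
  obtain ⟨g, hg, hgs⟩ := h3
  rw [map_mul] at hgs
  obtain ⟨m, hm, c, hc, h1⟩ := hopen g hg (left_ne_zero_of_mul hgs)
  have h4 := right_ne_zero_of_mul hgs
  rw [ev_lt, ← Units.val_mul] at h4
  obtain ⟨m', hm', c', hc', h2⟩ := hopen _ (mul_mem (inv_mem hx) hg) h4
  refine ⟨m * m'⁻¹, mul_mem hm (inv_mem hm'), c * c'⁻¹, mul_mem hc (inv_mem hc'), ?_⟩
  have e : x = g * (x⁻¹ * g)⁻¹ := by group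
  rw [e, h2, h1, hcomm m' hm' c' hc', mul_inv_rev]
  simp only [mul_assoc]
  rw [← mul_assoc m'⁻¹ c, hcomm _ (inv_mem hm') _ hc, mul_assoc]

end chevalley

end NDec

namespace NDec

section final

open scoped MatrixGroups
universe u
variable {n : ℕ} {K : Type u} [Field K] [IsAlgClosed K] [CharZero K]

lemma abelian_central {H D : Subgroup (GL (Fin n) K)}
    (hH : IsZClosed (H : Set (GL (Fin n) K))) (hconn : IsZConnected (H : Set (GL (Fin n) K)))
    (hred : IsReductiveSub H)
    (hDc : IsZClosed (D : Set (GL (Fin n) K))) (hD : NormalIn D H)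
    (hab : ∀ a ∈ D, ∀ b ∈ D, Commute a b) : ∀ d ∈ D, ∀ h ∈ H, Commute d h := by
  intro d hd h hh
  obtain ⟨m, hm, c, hc, rfl⟩ := key hH hconn hred hDc hD h hh
  exact (hab d hd m hm).mul_right (Subgroup.mem_centralizer_iff.1 hc.2 d hd)

lemma central_of_comm {H : Subgroup (GL (Fin n) K)}
    (hH : IsZClosed (H : Set (GL (Fin n) K))) (hconn : IsZConnected (H : Set (GL (Fin n) K)))
    (hred : IsReductiveSub H) {c : GL (Fin n) K} (hc : c ∈ H)
    (hcz : ∀ h ∈ H, ∀ k ∈ H, Commute (c * h * c⁻¹ * h⁻¹) k) : ∀ h ∈ H, Commute c h := by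
  let C : Subgroup (GL (Fin n) K) := H ⊓ Subgroup.centralizer ({c} : Set (GL (Fin n) K))
  have hC : ∀ y, y ∈ C ↔ y ∈ H ∧ Commute c y := by
    intro y
    rw [Subgroup.mem_inf, Subgroup.mem_centralizer_iff]
    simp [Commute, SemiconjBy]
  let D : Subgroup (GL (Fin n) K) := C ⊓ Subgroup.centralizer (C : Set (GL (Fin n) K))
  have hD : ∀ y, y ∈ D ↔ y ∈ C ∧ ∀ x ∈ C, Commute x y := by
    intro y
    rw [Subgroup.mem_inf, Subgroup.mem_centralizer_iff]
    rfl
  have hCc : IsZClosed (C : Set (GL (Fin n) K)) := closed_inter hH (closed_centralizer _)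
  have hDc : IsZClosed (D : Set (GL (Fin n) K)) := closed_inter hCc (closed_centralizer _)
  have hconj : ∀ h ∈ H, ∀ y ∈ C, h * y * h⁻¹ ∈ C := by
    intro h hh y hy
    rw [hC] at hy ⊢
    refine ⟨mul_mem (mul_mem hh hy.1) (inv_mem hh), ?_⟩
    have h1 : Commute (h⁻¹ * c * h) y := by
      have e : h⁻¹ * c * h = (c * h⁻¹ * c⁻¹ * h⁻¹⁻¹)⁻¹ * c := by group
      rw [e]
      exact ((hcz _ (inv_mem hh) y hy.1).inv_left).mul_left hy.2
    have h2 := (Commute.conj_iff h).2 h1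
    have e : h * (h⁻¹ * c * h) * h⁻¹ = c := by group
    rwa [e] at h2
  have hDn : NormalIn D H := by
    refine ⟨fun y hy => ((hC y).1 ((hD y).1 hy).1).1, fun h hh x hx => ?_⟩
    rw [hD] at hx ⊢
    refine ⟨hconj h hh x hx.1, fun y hy => ?_⟩
    have h1 := hx.2 _ (hconj _ (inv_mem hh) y hy)
    have h2 := (Commute.conj_iff h).2 h1
    have e : h * (h⁻¹ * y * h⁻¹⁻¹) * h⁻¹ = y := by group
    rwa [e] at h2
  refine abelian_central hH hconn hred hDc hDn (fun a ha b hb => ?_) c ?_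
  · exact ((hD b).1 hb).2 a ((hD a).1 ha).1
  · rw [hD]
    exact ⟨(hC c).2 ⟨hc, Commute.refl c⟩, fun x hx => ((hC x).1 hx).2.symm⟩

lemma main {H N A : Subgroup (GL (Fin n) K)}
    (hH : IsZClosed (H : Set (GL (Fin n) K))) (hconn : IsZConnected (H : Set (GL (Fin n) K)))
    (hred : IsReductiveSub H)
    (hNc : IsZClosed (N : Set (GL (Fin n) K))) (hN : NormalIn N H)
    (hAc : IsZClosed (A : Set (GL (Fin n) K))) (hA : NormalIn A H) :
    ∀ x ∈ N, ∃ a ∈ N ⊓ A,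
      ∃ b ∈ N ⊓ (H ⊓ Subgroup.centralizer (A : Set (GL (Fin n) K))), x = a * b := by
  intro x hx
  obtain ⟨a, ha, b, hb, hxab⟩ := key hH hconn hred hAc hA x (hN.1 hx)
  have hcA : ∀ b ∈ H ⊓ Subgroup.centralizer (A : Set (GL (Fin n) K)), ∀ a ∈ A, Commute a b :=
    fun b hb a ha => Subgroup.mem_centralizer_iff.1 hb.2 a ha
  have hMc : IsZClosed ((N ⊓ A : Subgroup (GL (Fin n) K)) : Set (GL (Fin n) K)) :=
    closed_inter hNc hAc
  have hMn : NormalIn (N ⊓ A) H :=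
    ⟨fun y hy => hN.1 hy.1, fun h hh y hy => ⟨hN.2 h hh y hy.1, hA.2 h hh y hy.2⟩⟩
  obtain ⟨m, hm, c, hc, hamc⟩ := key hH hconn hred hMc hMn a (hA.1 ha)
  have hcM : ∀ y ∈ N ⊓ A, Commute y c := fun y hy => Subgroup.mem_centralizer_iff.1 hc.2 y hy
  have hcc : c ∈ A := by
    have : c = m⁻¹ * a := by rw [hamc]; group
    rw [this]; exact mul_mem (inv_mem hm.2) ha
  have hcb : c * b = m⁻¹ * x := by rw [hxab, hamc]; group
  have hcbN : c * b ∈ N := by rw [hcb]; exact mul_mem (inv_mem hm.1) hx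
  -- the center of the intersection
  let Z : Subgroup (GL (Fin n) K) :=
    (N ⊓ A) ⊓ Subgroup.centralizer ((N ⊓ A : Subgroup (GL (Fin n) K)) : Set (GL (Fin n) K))
  have hZ : ∀ y, y ∈ Z ↔ y ∈ N ⊓ A ∧ ∀ x ∈ N ⊓ A, Commute x y := by
    intro y
    rw [Subgroup.mem_inf, Subgroup.mem_centralizer_iff]
    rfl
  have hZc : IsZClosed (Z : Set (GL (Fin n) K)) := closed_inter hMc (closed_centralizer _)
  have hZn : NormalIn Z H := by
    refine ⟨fun y hy => hMn.1 hy.1, fun h hh y hy => ?_⟩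
    rw [hZ] at hy ⊢
    refine ⟨hMn.2 h hh y hy.1, fun w hw => ?_⟩
    have h2 := (Commute.conj_iff h).2 (hy.2 _ (hMn.2 _ (inv_mem hh) w hw))
    have e : h * (h⁻¹ * w * h⁻¹⁻¹) * h⁻¹ = w := by group
    rwa [e] at h2
  have hZcen := abelian_central hH hconn hred hZc hZn
    (fun p hp q hq => ((hZ q).1 hq).2 p ((hZ p).1 hp).1)
  have hcomm : ∀ h ∈ H, c * h * c⁻¹ * h⁻¹ ∈ Z := by
    intro h hh
    rw [hZ]
    refine ⟨⟨?_, ?_⟩, ?_⟩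
    · obtain ⟨a', ha', b', hb', rfl⟩ := key hH hconn hred hAc hA h hh
      have e1 : b' * c⁻¹ = c⁻¹ * b' := ((hcA b' hb' c hcc).inv_left).eq.symm
      have e2 : b * a' = a' * b := (hcA b hb a' ha').eq.symm
      have e : c * (a' * b') * c⁻¹ * (a' * b')⁻¹ = (c * b) * (a' * (c * b)⁻¹ * a'⁻¹) := by
        calc c * (a' * b') * c⁻¹ * (a' * b')⁻¹
            = c * a' * (b' * c⁻¹) * b'⁻¹ * a'⁻¹ := by group
          _ = c * (a' * b) * b⁻¹ * c⁻¹ * a'⁻¹ := by rw [e1]; group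
          _ = (c * b) * (a' * (c * b)⁻¹ * a'⁻¹) := by rw [← e2]; group
      rw [e]
      exact mul_mem hcbN (hN.2 a' (hA.1 ha') _ (inv_mem hcbN))
    · have e : c * h * c⁻¹ * h⁻¹ = c * (h * c⁻¹ * h⁻¹) := by group
      rw [e]
      exact mul_mem hcc (hA.2 h hh _ (inv_mem hcc))
    · intro w hw
      have h2 := (Commute.conj_iff h).2 ((hcM _ (hMn.2 _ (inv_mem hh) w hw)).inv_right)
      have e : h * (h⁻¹ * w * h⁻¹⁻¹) * h⁻¹ = w := by group
      rw [e] at h2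
      have h3 := (hcM w hw).mul_right h2
      have e' : c * (h * c⁻¹ * h⁻¹) = c * h * c⁻¹ * h⁻¹ := by group
      rwa [e'] at h3
  have hccen := central_of_comm hH hconn hred (hA.1 hcc) (fun h hh k hk => hZcen _ (hcomm h hh) k hk)
  refine ⟨m, hm, c * b, ⟨hcbN, mul_mem (hA.1 hcc) hb.1, ?_⟩, by rw [hxab, hamc, mul_assoc]⟩
  refine Subgroup.mem_centralizer_iff.2 fun y hy => ?_
  exact ((hccen y (hA.1 hy)).symm.mul_right (hcA b hb y hy)).eq

end final

end NDec

/-- for normal algebraic subgroups `N`, `A` of a connected reductive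
group `H` and `B = C_H(A)`, one has `N = (N ∩ A)(N ∩ B)`. -/
theorem normal_decomposes_along_normal_and_centralizer
    {n : ℕ} {K : Type*} [Field K] [IsAlgClosed K] [CharZero K]
    (H N A : Subgroup (GL (Fin n) K))
    (hHclosed : IsZClosed (H : Set (GL (Fin n) K)))
    (hHconn : IsZConnected (H : Set (GL (Fin n) K)))
    (hHred : IsReductiveSub H)
    (hNclosed : IsZClosed (N : Set (GL (Fin n) K)))
    (hNnormal : NormalIn N H)
    (hAclosed : IsZClosed (A : Set (GL (Fin n) K)))
    (hAnormal : NormalIn A H) :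
    ∀ x ∈ N, ∃ a ∈ N ⊓ A,
      ∃ b ∈ N ⊓ (H ⊓ Subgroup.centralizer (A : Set (GL (Fin n) K))), x = a * b := by
  exact NDec.main hHclosed hHconn hHred hNclosed hNnormal hAclosed hAnormal
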